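/- Let F be a discretely valued Henselian field with perfect residue field and r ≥ 0 a real number. Then for every finite Galois subextension M/F of F^sep/F, the restriction map I_F^r → Gal(M/F)^r, sending an element of the upper ramification subgroup I_F^r ⊆ Γ_F to its image in Gal(M/F), is surjective. -/

import Mathlib

noncomputable section

open scoped Classical

/-- An additive `ℝ ∪ {⊤}`-valued valuation on a field `Ω`. -/
structure AddVal (Ω : Type*) [Field Ω] where
  v : Ω → WithTop ℝ
  v_zero : v 0 = ⊤
  v_ne_top : ∀ x : Ω, x ≠ 0 → v x ≠ ⊤
  v_mul : ∀ x y : Ω, v (x * y) = v x + v y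
  v_min_le_add : ∀ x y : Ω, min (v x) (v y) ≤ v (x + y)

namespace AddVal

variable {Ω : Type*} [Field Ω]

/-- `V` is normalized on `F`: its value group on `F^×` is exactly `ℤ`.
This encodes that `F` is a discretely valued field and `V` extends the
normalized discrete valuation `val_F` of `F`. -/
def IsNormalizedOn (V : AddVal Ω) (F : Type*) [Field F] [Algebra F Ω] : Prop :=
  (∀ x : F, x ≠ 0 → ∃ k : ℤ, V.v (algebraMap F Ω x) = ((k : ℝ) : WithTop ℝ)) ∧
    (∃ x : F, V.v (algebraMap F Ω x) = ((1 : ℝ) : WithTop ℝ))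

/-- Henselian property of the valued field `(F, val_F)` (simple-root Hensel lemma). -/
def IsHenselianOn (V : AddVal Ω) (F : Type*) [Field F] [Algebra F Ω] : Prop :=
  ∀ f : Polynomial F,
    (∀ i : ℕ, 0 ≤ V.v (algebraMap F Ω (f.coeff i))) →
      ∀ a₀ : F, 0 ≤ V.v (algebraMap F Ω a₀) →
        0 < V.v (algebraMap F Ω (Polynomial.eval a₀ f)) →
        V.v (algebraMap F Ω (Polynomial.eval a₀ (Polynomial.derivative f))) = 0 →
        ∃ a : F, Polynomial.eval a f = 0 ∧ 0 < V.v (algebraMap F Ω (a - a₀))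

/-- The residue field of `(F, val_F)` is perfect: in positive residue characteristic `p`,
the Frobenius is surjective on the residue field. -/
def HasPerfectResidueFieldOn (V : AddVal Ω) (F : Type*) [Field F] [Algebra F Ω] : Prop :=
  ∀ p : ℕ, p.Prime → 0 < V.v (algebraMap F Ω (p : F)) →
    ∀ x : F, 0 ≤ V.v (algebraMap F Ω x) →
      ∃ y : F, 0 ≤ V.v (algebraMap F Ω y) ∧ 0 < V.v (algebraMap F Ω (x - y ^ p))

/-- `e` is the (absolute) ramification index of `E` over the field on which `V` is
normalized: the value group of `E^×` is exactly `(1/e)ℤ`.  In particular `E` is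
finitely ramified. -/
def IsRamIdx (V : AddVal Ω) {K : Type*} [Field K] [Algebra K Ω]
    (E : IntermediateField K Ω) (e : ℕ) : Prop :=
  0 < e ∧
    (∀ x : ↥E, x ≠ 0 → ∃ k : ℤ, V.v (x : Ω) = ((((k : ℝ) / (e : ℝ) : ℝ)) : WithTop ℝ)) ∧
    (∃ x : ↥E, V.v (x : Ω) = (((1 / (e : ℝ) : ℝ)) : WithTop ℝ))

end AddVal

/-- The lower ramification relation `Ξ_r` on `K`-algebra embeddings of `E` into `Ω`,
where `e` is the absolute ramification index of `E` (over the normalization field of `V`):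
`σ Ξ_r τ` iff `val_M (σ x - τ x) ≥ e(M/E) (r+1)` for all integral `x` and any (equivalently
some) suitable Galois `M`; this is equivalent to `V.v (σ x - τ x) ≥ (r+1)/e` for all
integral `x`. -/
def xiRel {Ω : Type*} [Field Ω] (V : AddVal Ω) {K : Type*} [Field K] [Algebra K Ω]
    (E : IntermediateField K Ω) (e : ℕ) (r : ℝ) (σ τ : ↥E →ₐ[K] Ω) : Prop :=
  ∀ x : ↥E, 0 ≤ V.v (x : Ω) →
    ((((r + 1) / (e : ℝ) : ℝ)) : WithTop ℝ) ≤ V.v (σ x - τ x)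

/-- `g_t`: the (common) cardinality of a `Ξ_t`-equivalence class, realized as the
cardinality of the class of the inclusion `E ↪ Ω`. -/
def gfun {Ω : Type*} [Field Ω] (V : AddVal Ω) {K : Type*} [Field K] [Algebra K Ω]
    (E : IntermediateField K Ω) (e : ℕ) (t : ℝ) : ℕ :=
  Nat.card {σ : ↥E →ₐ[K] Ω // xiRel V E e t σ E.val}

/-- The Herbrand function `φ_{E/K}(r) = ∫_0^r (g_t / g_0) dt`. -/
def herbrand {Ω : Type*} [Field Ω] (V : AddVal Ω) {K : Type*} [Field K] [Algebra K Ω]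
    (E : IntermediateField K Ω) (e : ℕ) (r : ℝ) : ℝ :=
  ∫ t in (0:ℝ)..r, ((gfun V E e t : ℝ) / (gfun V E e 0 : ℝ))

/-- `E/K` is at most `l`-ramified: for every finite subextension `E₀/K` the relation
`Ξ^l = Ξ_{ψ_{E₀/K}(l)}` is trivial. -/
def atMostRamified {Ω : Type*} [Field Ω] (V : AddVal Ω) {K : Type*} [Field K] [Algebra K Ω]
    (E : IntermediateField K Ω) (l : ℝ) : Prop :=
  ∀ E₀ : IntermediateField K Ω, E₀ ≤ E → FiniteDimensional K ↥E₀ →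
    ∀ (e₀ : ℕ) (s : ℝ), V.IsRamIdx E₀ e₀ → 0 ≤ s → herbrand V E₀ e₀ s = l →
      ∀ σ τ : ↥E₀ →ₐ[K] Ω, xiRel V E₀ e₀ s σ τ → σ = τ

/-- Membership of `γ ∈ Γ_K` in the upper ramification subgroup `I_K^l`: for every
finite Galois subextension `M/K` (with ramification index `eM` and `ψ_{M/K}(l) = sM`),
the image of `γ` in `Gal(M/K)` lies in `Gal(M/K)^l = Gal(M/K)_{ψ_{M/K}(l)}`. -/
def inUpperRam {Ω : Type*} [Field Ω] (V : AddVal Ω) {K : Type*} [Field K] [Algebra K Ω]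
    (l : ℝ) (γ : Ω ≃ₐ[K] Ω) : Prop :=
  ∀ (M : IntermediateField K Ω) (eM : ℕ) (sM : ℝ),
    FiniteDimensional K ↥M → IsGalois K ↥M → V.IsRamIdx M eM → 0 ≤ sM →
      herbrand V M eM sM = l →
      xiRel V M eM sM (γ.toAlgHom.comp M.val) M.val

open Polynomial IsLocalRing in
/-- A monogenicity criterion: a finite extension of a local ring by a discrete valuation ring with
separable residue extension is generated by one element. -/
theorem exists_adjoin_eq_top_of_isSeparable_residueField
    {A B : Type*} [CommRing A] [IsLocalRing A] [CommRing B] [IsDomain B]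
    [IsDiscreteValuationRing B] [Algebra A B] [Module.Finite A B]
    [IsLocalHom (algebraMap A B)]
    [Algebra.IsSeparable (ResidueField A) (ResidueField B)]
    (hA : (maximalIdeal A).map (algebraMap A B) ≠ ⊥) :
    ∃ x : B, Algebra.adjoin A {x} = ⊤ := by
  have hfin : Module.Finite (ResidueField A) (ResidueField B) := inferInstance
  obtain ⟨θ, hθ⟩ := Field.exists_primitive_element (ResidueField A) (ResidueField B)
  have hθi : IsIntegral (ResidueField A) θ := Algebra.IsIntegral.isIntegral θ
  obtain ⟨f, hf, -, hfm⟩ := lifts_and_natDegree_eq_and_monic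
    ((mem_lifts _).mpr (map_surjective (residue A) (residue_surjective) (minpoly (ResidueField A) θ)))
    (minpoly.monic hθi)
  -- reduction of `aeval`
  have hred : ∀ (g : A[X]) (y : B), residue B (aeval y g) =
      aeval (residue B y) (g.map (residue A)) := by
    intro g y
    exact map_aeval_eq_aeval_map (ψ := residue B) (φ := residue A) rfl g y
  obtain ⟨π, hπ⟩ := IsDiscreteValuationRing.exists_irreducible B
  have hmax := (IsDiscreteValuationRing.irreducible_iff_uniformizer π).mp hπ
  have hder : ∀ y : B, residue B y = θ → IsUnit (aeval y (derivative f)) := by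
    intro y hy
    rw [← residue_ne_zero_iff_isUnit, hred, hy, ← derivative_map, hf]
    exact Separable.aeval_derivative_ne_zero (Algebra.IsSeparable.isSeparable _ θ)
      (minpoly.aeval _ _)
  have hroot : ∀ y : B, residue B y = θ → aeval y f ∈ maximalIdeal B := by
    intro y hy
    rw [← residue_eq_zero_iff, hred, hy, hf, minpoly.aeval]
  obtain ⟨x, hx, u, hu⟩ : ∃ x : B, residue B x = θ ∧ ∃ u : B, π = u * aeval x f := by
    obtain ⟨y, hy⟩ := residue_surjective (R := B) θ
    have hy1 := hroot y hy
    rw [hmax, Ideal.mem_span_singleton'] at hy1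
    obtain ⟨c, hc⟩ := hy1
    by_cases hcu : IsUnit c
    · obtain ⟨c, rfl⟩ := hcu
      exact ⟨y, hy, ((c⁻¹ : Bˣ) : B), by rw [← hc, Units.inv_mul_cancel_left]⟩
    · obtain ⟨k, hk⟩ := (f.map (algebraMap A B)).binomExpansion y π
      simp only [derivative_map, eval_map_algebraMap] at hk
      have hunit : IsUnit (c + aeval y (derivative f) + k * π) := by
        have h1 : c + k * π ∈ maximalIdeal B :=
          add_mem ((mem_maximalIdeal c).mpr hcu) (Ideal.mul_mem_left _ _
            (hmax ▸ Ideal.mem_span_singleton_self π))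
        have h2 := hder y hy
        rw [← residue_ne_zero_iff_isUnit] at h2 ⊢
        rw [add_right_comm, map_add, (residue_eq_zero_iff _).mpr h1, zero_add]
        exact h2
      obtain ⟨u, hu⟩ := hunit
      have hπ0 : residue B π = 0 :=
        (residue_eq_zero_iff _).mpr (hmax ▸ Ideal.mem_span_singleton_self π)
      refine ⟨y + π, by rw [map_add, hπ0, add_zero, hy], ((u⁻¹ : Bˣ) : B), ?_⟩
      rw [hk, ← hc, show c * π + aeval y (derivative f) * π + k * π ^ 2 =
        (u : B) * π by rw [hu]; ring, Units.inv_mul_cancel_left]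
  refine ⟨x, ?_⟩
  set S := Algebra.adjoin A {x}
  have hmem : ∀ g : A[X], aeval x g ∈ S := fun g => by
    exact aeval_mem_adjoin_singleton A x
  have hstep : ∀ z : B, ∃ s ∈ S, ∃ w : B, z = s + aeval x f * w := by
    intro z
    have : residue B z ∈ (⊤ : IntermediateField (ResidueField A) (ResidueField B)) := trivial
    rw [← hθ, ← IntermediateField.mem_toSubalgebra,
      IntermediateField.adjoin_simple_toSubalgebra_of_isAlgebraic hθi.isAlgebraic,
      Algebra.adjoin_singleton_eq_range_aeval] at this
    obtain ⟨g, hg⟩ := this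
    obtain ⟨g, rfl⟩ := map_surjective (residue A) residue_surjective g
    have h0 : z - aeval x g ∈ maximalIdeal B := by
      rw [← residue_eq_zero_iff, map_sub, hred, hx, sub_eq_zero]
      exact hg.symm
    rw [hmax, Ideal.mem_span_singleton'] at h0
    obtain ⟨w, hw⟩ := h0
    exact ⟨_, hmem g, w * u, by rw [mul_comm w u, ← mul_assoc, mul_comm _ u, ← hu, mul_comm π, hw]; ring⟩
  have hpow : ∀ (n : ℕ) (z : B), ∃ s ∈ S, ∃ w : B, z = s + aeval x f ^ n * w := by
    intro n
    induction n with
    | zero => exact fun z => ⟨0, zero_mem _, z, by simp⟩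
    | succ n ih =>
      intro z
      obtain ⟨s, hs, w, rfl⟩ := ih z
      obtain ⟨t, ht, w', rfl⟩ := hstep w
      exact ⟨s + aeval x f ^ n * t, add_mem hs (mul_mem (pow_mem (hmem f) n) ht), w', by ring⟩
  obtain ⟨n, hn⟩ := IsDiscreteValuationRing.ideal_eq_span_pow_irreducible hA hπ
  have hle : (⊤ : Submodule A B) ≤ Subalgebra.toSubmodule S ⊔ maximalIdeal A • ⊤ := by
    intro z _
    obtain ⟨s, hs, w, rfl⟩ := hpow n z
    refine Submodule.add_mem_sup hs ?_
    rw [Ideal.smul_top_eq_map, Submodule.restrictScalars_mem, hn, Ideal.mem_span_singleton]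
    obtain ⟨c, hc⟩ : π ∣ aeval x f := by
      rw [← Ideal.mem_span_singleton, ← hmax]; exact hroot x hx
    exact (pow_dvd_pow_of_dvd ⟨c, hc⟩ n).mul_right w
  have := Submodule.le_of_le_smul_of_le_jacobson_bot (Module.finite_def.mp inferInstance)
    (IsLocalRing.maximalIdeal_le_jacobson ⊥) hle
  rw [← Algebra.toSubmodule_eq_top]
  exact top_le_iff.mp this

namespace AddVal

open Polynomial

section Basic

variable {L : Type*} [Field L] (V : AddVal L)

theorem v_one : V.v 1 = 0 := by
  have h := V.v_mul 1 1
  have h1 := V.v_ne_top 1 one_ne_zero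
  rw [mul_one] at h
  generalize V.v 1 = a at h h1
  lift a to ℝ using h1
  norm_cast at h ⊢
  linarith

/-- The associated valuation in the sense of `AddValuation`. -/
def toAddValuation : AddValuation L (WithTop ℝ) :=
  AddValuation.of V.v V.v_zero V.v_one V.v_min_le_add V.v_mul

theorem v_eq_top_iff {x : L} : V.v x = ⊤ ↔ x = 0 :=
  ⟨fun h => by_contra fun h' => V.v_ne_top x h' h, fun h => h ▸ V.v_zero⟩

theorem v_neg (x : L) : V.v (-x) = V.v x := V.toAddValuation.map_neg x

theorem v_sub_comm (x y : L) : V.v (x - y) = V.v (y - x) := V.toAddValuation.map_sub_swap x y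

theorem le_v_add {a : WithTop ℝ} {x y : L} (hx : a ≤ V.v x) (hy : a ≤ V.v y) :
    a ≤ V.v (x + y) := (le_min hx hy).trans (V.v_min_le_add x y)

theorem le_v_sub {a : WithTop ℝ} {x y : L} (hx : a ≤ V.v x) (hy : a ≤ V.v y) :
    a ≤ V.v (x - y) := by
  rw [sub_eq_add_neg]; exact V.le_v_add hx (by rwa [V.v_neg])

theorem le_v_sum {ι : Type*} (s : Finset ι) (f : ι → L) {a : WithTop ℝ}
    (h : ∀ i ∈ s, a ≤ V.v (f i)) : a ≤ V.v (∑ i ∈ s, f i) :=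
  Finset.sum_induction f (a ≤ V.v ·) (fun _ _ => V.le_v_add) (by simp [V.v_zero]) h

theorem lt_v_add {a : WithTop ℝ} {x y : L} (hx : a < V.v x) (hy : a < V.v y) :
    a < V.v (x + y) := (lt_min hx hy).trans_le (V.v_min_le_add x y)

theorem lt_v_sub {a : WithTop ℝ} {x y : L} (hx : a < V.v x) (hy : a < V.v y) :
    a < V.v (x - y) := by
  rw [sub_eq_add_neg]; exact V.lt_v_add hx (by rwa [V.v_neg])

theorem v_add_eq_left {x y : L} (h : V.v x < V.v y) : V.v (x + y) = V.v x := by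
  refine le_antisymm (le_of_not_gt fun h' => ?_) (V.le_v_add le_rfl h.le)
  have := V.lt_v_sub h' h
  simp at this

theorem v_prod {ι : Type*} (s : Finset ι) (f : ι → L) :
    V.v (∏ i ∈ s, f i) = ∑ i ∈ s, V.v (f i) := by
  induction s using Finset.induction_on with
  | empty => simp [V.v_one]
  | insert a s ha ih => rw [Finset.prod_insert ha, Finset.sum_insert ha, V.v_mul, ih]

theorem v_pow (x : L) (n : ℕ) : V.v (x ^ n) = n • V.v x := V.toAddValuation.map_pow x n

theorem v_inv_coe {x : L} {r : ℝ} (h : V.v x = (r : WithTop ℝ)) :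
    V.v x⁻¹ = ((-r : ℝ) : WithTop ℝ) := by
  have hx : x ≠ 0 := fun h0 => by simp [h0, V.v_zero] at h
  have h1 := V.v_mul x x⁻¹
  have h2 := V.v_ne_top x⁻¹ (inv_ne_zero hx)
  rw [mul_inv_cancel₀ hx, V.v_one, h] at h1
  generalize V.v x⁻¹ = a at *
  lift a to ℝ using h2
  norm_cast at h1 ⊢
  linarith

/-- Restriction of a valuation along a ring homomorphism of fields. -/
def comap {K : Type*} [Field K] (f : K →+* L) : AddVal K where
  v x := V.v (f x)
  v_zero := by rw [map_zero, V.v_zero]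
  v_ne_top x hx := V.v_ne_top _ ((map_ne_zero f).mpr hx)
  v_mul x y := by rw [map_mul, V.v_mul]
  v_min_le_add x y := by rw [map_add]; exact V.v_min_le_add _ _

theorem comap_v {K : Type*} [Field K] (f : K →+* L) (x : K) : (V.comap f).v x = V.v (f x) := rfl

/-- The ring of integers. -/
def integers : ValuationSubring L where
  carrier := {x | 0 ≤ V.v x}
  mul_mem' {a b} ha hb := by
    simp only [Set.mem_ofPred_eq] at *
    rw [V.v_mul]; exact add_nonneg ha hb
  one_mem' := V.v_one.ge
  add_mem' ha hb := V.le_v_add ha hb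
  zero_mem' := by simp [V.v_zero]
  neg_mem' {x} hx := by simpa [V.v_neg] using hx
  mem_or_inv_mem' x := by
    by_cases hx : x = 0
    · left; simp [hx, V.v_zero]
    obtain ⟨r, hr⟩ := WithTop.ne_top_iff_exists.mp (V.v_ne_top x hx)
    rcases le_total 0 r with h | h
    · left; simp only [Set.mem_ofPred_eq, ← hr]; exact_mod_cast h
    · right
      simp only [Set.mem_ofPred_eq, V.v_inv_coe hr.symm]
      have : 0 ≤ -r := by linarith
      exact_mod_cast this

theorem mem_integers {x : L} : x ∈ V.integers ↔ 0 ≤ V.v x := Iff.rfl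

theorem isUnit_integers_iff (x : V.integers) : IsUnit x ↔ V.v (x : L) = 0 := by
  constructor
  · rintro ⟨u, rfl⟩
    have h1 : V.v ((u : V.integers) : L) + V.v (((u⁻¹ : (V.integers)ˣ) : V.integers) : L) = 0 := by
      rw [← V.v_mul, ← V.v_one]
      congr 1
      exact_mod_cast congrArg Subtype.val (Units.mul_inv u)
    exact le_antisymm (h1 ▸ le_add_of_nonneg_right (u⁻¹ : (V.integers)ˣ).val.2) (u : V.integers).2
  · intro h
    have hx : (x : L) ≠ 0 := fun h0 => by simp [h0, V.v_zero] at h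
    have h2 := V.v_inv_coe (x := (x : L)) (r := 0) (by simpa using h)
    exact IsUnit.of_mul_eq_one ⟨(x : L)⁻¹, by rw [V.mem_integers, h2]; simp⟩
      (Subtype.ext (mul_inv_cancel₀ hx))

theorem mem_maximalIdeal_integers_iff (x : V.integers) :
    x ∈ IsLocalRing.maximalIdeal V.integers ↔ 0 < V.v (x : L) := by
  rw [IsLocalRing.mem_maximalIdeal, mem_nonunits_iff, V.isUnit_integers_iff]
  exact ⟨fun h => lt_of_le_of_ne x.2 (Ne.symm h), fun h => h.ne'⟩

theorem dvd_integers_iff (x y : V.integers) : x ∣ y ↔ V.v (x : L) ≤ V.v (y : L) := by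
  constructor
  · rintro ⟨c, rfl⟩
    change V.v (x : L) ≤ V.v ((x : L) * (c : L))
    rw [V.v_mul]
    exact le_add_of_nonneg_right c.2
  · intro h
    by_cases hx : (x : L) = 0
    · rw [hx, V.v_zero, top_le_iff, V.v_eq_top_iff] at h
      exact ⟨0, Subtype.ext (by simp [h])⟩
    obtain ⟨r, hr⟩ := WithTop.ne_top_iff_exists.mp (V.v_ne_top _ hx)
    refine ⟨⟨(y : L) * (x : L)⁻¹, ?_⟩, Subtype.ext ?_⟩
    · rw [V.mem_integers, V.v_mul, V.v_inv_coe hr.symm]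
      rw [← hr] at h
      calc (0 : WithTop ℝ) = (r : WithTop ℝ) + ((-r : ℝ) : WithTop ℝ) := by
            norm_cast; simp
        _ ≤ _ := by gcongr
    · simp [mul_comm (y : L), mul_inv_cancel_left₀ hx]

theorem prod_X_sub_C_mem_lifts {ι : Type*} (s : Finset ι) (f : ι → L)
    (hf : ∀ i ∈ s, 0 ≤ V.v (f i)) :
    ∏ i ∈ s, (X - C (f i)) ∈ lifts (algebraMap V.integers L) := by
  refine prod_mem fun i hi => ?_
  rw [mem_lifts]
  exact ⟨X - C ⟨f i, hf i hi⟩, by simp⟩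

theorem v_coeff_nonneg_of_mem_lifts {p : L[X]} (hp : p ∈ lifts (algebraMap V.integers L)) (n : ℕ) :
    0 ≤ V.v (p.coeff n) := by
  obtain ⟨q, rfl⟩ := (mem_lifts _).mp hp
  rw [coeff_map]
  exact (q.coeff n).2

theorem v_eval_nonneg {p : L[X]} (hp : ∀ n, 0 ≤ V.v (p.coeff n)) {x : L} (hx : 0 ≤ V.v x) :
    0 ≤ V.v (p.eval x) := by
  rw [eval_eq_sum_range]
  refine sum_mem (S := V.integers) fun i _ => mul_mem (hp i) (pow_mem (S := V.integers) hx i)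

end Basic

section AbsoluteValue

variable {L : Type*} [Field L] (V : AddVal L)

/-- The real absolute value `x ↦ exp (-v x)`. -/
def toAbs : AbsoluteValue L ℝ where
  toFun x := if x = 0 then 0 else Real.exp (-(V.v x).untopD 0)
  map_mul' x y := by
    by_cases hx : x = 0
    · simp [hx]
    by_cases hy : y = 0
    · simp [hy]
    obtain ⟨r, hr⟩ := WithTop.ne_top_iff_exists.mp (V.v_ne_top x hx)
    obtain ⟨s, hs⟩ := WithTop.ne_top_iff_exists.mp (V.v_ne_top y hy)
    have : V.v (x * y) = ((r + s : ℝ) : WithTop ℝ) := by rw [V.v_mul, ← hr, ← hs]; rfl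
    simp only [mul_eq_zero, hx, hy, or_self, if_false, ← hr, ← hs, this, WithTop.untopD_coe,
      ← Real.exp_add]
    congr 1
    ring
  nonneg' x := by
    split_ifs
    · exact le_rfl
    · positivity
  eq_zero' x := by
    split_ifs with h
    · simp [h]
    · simp [h, (Real.exp_pos _).ne']
  add_le' x y := by
    by_cases hx : x = 0
    · simp [hx]
    by_cases hy : y = 0
    · simp [hy]
    by_cases hxy : x + y = 0
    · simp only [hxy, if_true, hx, hy, if_false]; positivity
    obtain ⟨r, hr⟩ := WithTop.ne_top_iff_exists.mp (V.v_ne_top x hx)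
    obtain ⟨s, hs⟩ := WithTop.ne_top_iff_exists.mp (V.v_ne_top y hy)
    obtain ⟨t, ht⟩ := WithTop.ne_top_iff_exists.mp (V.v_ne_top _ hxy)
    have h := V.v_min_le_add x y
    simp only [hx, hy, hxy, if_false, ← hr, ← hs, ← ht, WithTop.untopD_coe] at h ⊢
    norm_cast at h
    rcases min_le_iff.mp h with h | h
    · have : Real.exp (-t) ≤ Real.exp (-r) := Real.exp_le_exp.mpr (by linarith)
      linarith [Real.exp_pos (-s)]
    · have : Real.exp (-t) ≤ Real.exp (-s) := Real.exp_le_exp.mpr (by linarith)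
      linarith [Real.exp_pos (-r)]

theorem toAbs_eq_exp {x : L} {r : ℝ} (h : V.v x = (r : WithTop ℝ)) :
    V.toAbs x = Real.exp (-r) := by
  have hx : x ≠ 0 := fun h0 => by simp [h0, V.v_zero] at h
  change (if x = 0 then 0 else Real.exp (-(V.v x).untopD 0)) = _
  rw [if_neg hx, h, WithTop.untopD_coe]

theorem toAbs_lt_one_iff {x : L} : V.toAbs x < 1 ↔ 0 < V.v x := by
  by_cases hx : x = 0
  · simp [hx, V.v_zero]
  obtain ⟨r, hr⟩ := WithTop.ne_top_iff_exists.mp (V.v_ne_top x hx)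
  rw [V.toAbs_eq_exp hr.symm, ← hr, Real.exp_lt_one_iff]
  norm_cast
  exact neg_lt_zero

theorem one_lt_toAbs_iff {x : L} : 1 < V.toAbs x ↔ V.v x < 0 := by
  by_cases hx : x = 0
  · simp [hx, V.v_zero]
  obtain ⟨r, hr⟩ := WithTop.ne_top_iff_exists.mp (V.v_ne_top x hx)
  rw [V.toAbs_eq_exp hr.symm, ← hr, Real.one_lt_exp_iff]
  norm_cast
  exact neg_pos

theorem toAbs_eq_iff {W : AddVal L} {x : L} : V.toAbs x = W.toAbs x ↔ V.v x = W.v x := by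
  by_cases hx : x = 0
  · simp [hx, V.v_zero, W.v_zero]
  obtain ⟨r, hr⟩ := WithTop.ne_top_iff_exists.mp (V.v_ne_top x hx)
  obtain ⟨s, hs⟩ := WithTop.ne_top_iff_exists.mp (W.v_ne_top x hx)
  rw [V.toAbs_eq_exp hr.symm, W.toAbs_eq_exp hs.symm, ← hr, ← hs]
  simp

end AbsoluteValue

section Invariance

variable {F L : Type*} [Field F] [Field L] [Algebra F L] (V : AddVal L)

theorem v_one_sub_of_pos {x : L} (hx : 0 < V.v x) : V.v (1 - x) = 0 := by
  rw [sub_eq_add_neg, V.v_add_eq_left, V.v_one]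
  rwa [V.v_one, V.v_neg]

/-- Weak approximation for the conjugates of a valuation. -/
theorem exists_separating (hn : V.IsNormalizedOn F) (hfin : Finite (L ≃ₐ[F] L)) :
    ∃ a : L, V.v a < 0 ∧ ∀ σ : L ≃ₐ[F] L, (∃ x, V.v (σ x) ≠ V.v x) → 0 < V.v (σ a) := by
  obtain ⟨ϖ, hϖ⟩ := hn.2
  let w : (L ≃ₐ[F] L) → AbsoluteValue L ℝ := fun σ => (V.comap (σ : L →+* L)).toAbs
  have hwϖ (σ) : w σ (algebraMap F L ϖ) = Real.exp (-1) := by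
    refine toAbs_eq_exp _ ?_
    rw [comap_v, ← hϖ]
    simp
  have h1 : ∀ i : Set.range w, (i : AbsoluteValue L ℝ).IsNontrivial := by
    rintro ⟨_, σ, rfl⟩
    refine ⟨algebraMap F L ϖ, fun h0 => by simp [h0, V.v_zero] at hϖ, ?_⟩
    rw [hwϖ]
    simp
  have h2 : Pairwise fun i j : Set.range w =>
      ¬ (i : AbsoluteValue L ℝ).IsEquiv (j : AbsoluteValue L ℝ) := by
    rintro ⟨_, σ, rfl⟩ ⟨_, τ, rfl⟩ hne heq
    refine hne (Subtype.ext ?_)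
    obtain ⟨c, hc, h⟩ := AbsoluteValue.isEquiv_iff_exists_rpow_eq.mp heq
    have h3 := congrFun h (algebraMap F L ϖ)
    simp only [hwϖ] at h3
    rw [← Real.exp_mul, Real.exp_eq_exp] at h3
    obtain rfl : c = 1 := by linarith
    refine AbsoluteValue.ext fun x => ?_
    simpa using congrFun h x
  obtain ⟨a, ha, hb⟩ := AbsoluteValue.exists_one_lt_lt_one_pi_of_not_isEquiv h1 h2 ⟨w 1, 1, rfl⟩
  refine ⟨a, (one_lt_toAbs_iff _).mp ha, ?_⟩
  rintro σ ⟨x, hx⟩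
  refine (toAbs_lt_one_iff (V.comap (σ : L →+* L))).mp (hb ⟨w σ, σ, rfl⟩ fun h => hx ?_)
  have h4 := DFunLike.congr_fun (congrArg Subtype.val h) x
  exact (toAbs_eq_iff _).mp h4

variable [FiniteDimensional F L] [IsGalois F L]

/-- A finite Galois-stable set in `L` meeting the principal units in exactly one element, and
otherwise consisting of topologically nilpotent elements, is a singleton over a henselian base. -/
theorem fixed_of_henselian (hh : V.IsHenselianOn F) (S : Finset L)
    (hS : ∀ σ : L ≃ₐ[F] L, S.image σ = S) {b : L} (hbS : b ∈ S)
    (hb : 0 < V.v (1 - b)) (hS' : ∀ y ∈ S, y ≠ b → 0 < V.v y) (σ : L ≃ₐ[F] L) : σ b = b := by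
  have hnn : ∀ y ∈ S, 0 ≤ V.v y := by
    intro y hy
    by_cases h : y = b
    · have : V.v (1 - (1 - b)) = 0 := V.v_one_sub_of_pos hb
      rw [h]
      rw [sub_sub_cancel] at this
      exact this.ge
    · exact (hS' y hy h).le
  set R : L[X] := ∏ y ∈ S, (X - C y) with hR
  have hRF : R ∈ lifts (algebraMap F L) := by
    rw [lifts_iff_coeff_lifts]
    intro n
    rw [IsGalois.mem_range_algebraMap_iff_fixed]
    intro τ
    have : R.map (τ : L →+* L) = R := by
      rw [hR, Polynomial.map_prod]
      conv_rhs => rw [← hS τ, Finset.prod_image (fun _ _ _ _ h => τ.injective h)]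
      simp
    conv_rhs => rw [← this, coeff_map]
    rfl
  obtain ⟨f, hf⟩ := (mem_lifts _).mp hRF
  have heval (x : F) : algebraMap F L (f.eval x) = R.eval (algebraMap F L x) := by
    rw [← hf, eval_map_algebraMap, aeval_algebraMap_apply_eq_algebraMap_eval]
  have hfac : R = (X - C b) * ∏ y ∈ S.erase b, (X - C y) := (Finset.mul_prod_erase S _ hbS).symm
  have hQ : V.v ((∏ y ∈ S.erase b, (X - C y)).eval 1) = 0 := by
    rw [eval_prod, V.v_prod]
    refine Finset.sum_eq_zero fun y hy => ?_
    simpa using V.v_one_sub_of_pos (hS' y (Finset.mem_of_mem_erase hy) (Finset.ne_of_mem_erase hy))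
  have hQ' : 0 ≤ V.v ((derivative (∏ y ∈ S.erase b, (X - C y))).eval 1) := by
    refine V.v_eval_nonneg (fun n => ?_) V.v_one.ge
    rw [coeff_derivative]
    have h1 := V.v_coeff_nonneg_of_mem_lifts (V.prod_X_sub_C_mem_lifts (S.erase b) id
      fun y hy => hnn y (Finset.mem_of_mem_erase hy)) (n + 1)
    have h2 : ((n : L) + 1) ∈ V.integers := by exact_mod_cast natCast_mem V.integers (n + 1)
    exact V.integers.mul_mem _ _ h1 h2
  obtain ⟨a, ha, ha1⟩ := hh f (fun n => by
      rw [← coeff_map, hf]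
      exact V.v_coeff_nonneg_of_mem_lifts (V.prod_X_sub_C_mem_lifts S id hnn) n) 1
    (by rw [map_one, V.v_one])
    (by
      rw [heval, hfac, map_one, eval_mul, V.v_mul, hQ, add_zero]
      simpa using hb)
    (by
      have : algebraMap F L (eval 1 (derivative f)) = (derivative R).eval 1 := by
        rw [← hf, derivative_map, eval_map_algebraMap, ← map_one (algebraMap F L),
          aeval_algebraMap_apply_eq_algebraMap_eval]
      rw [this, hfac, derivative_mul, eval_add, eval_mul, eval_mul]
      simp only [derivative_sub, derivative_X, derivative_C, sub_zero, eval_one, one_mul,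
        eval_sub, eval_X, eval_C]
      rw [V.v_add_eq_left, hQ]
      rw [hQ, V.v_mul]
      exact add_pos_of_pos_of_nonneg hb hQ')
  have ha0 : R.eval (algebraMap F L a) = 0 := by rw [← heval, ha, map_zero]
  rw [hR, eval_prod, Finset.prod_eq_zero_iff] at ha0
  obtain ⟨y, hy, hya⟩ := ha0
  simp only [eval_sub, eval_X, eval_C, sub_eq_zero] at hya
  have hyb : y = b := by
    by_contra h
    have h1 := V.v_one_sub_of_pos (hS' y hy h)
    rw [← hya, ← V.v_neg, neg_sub, ← map_one (algebraMap F L), ← map_sub] at h1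
    exact ha1.ne' h1
  rw [← hyb, ← hya, AlgEquiv.commutes]

theorem v_galois (hn : V.IsNormalizedOn F) (hh : V.IsHenselianOn F) (σ : L ≃ₐ[F] L) (x : L) :
    V.v (σ x) = V.v x := by
  obtain ⟨a, ha, hσa⟩ := V.exists_separating hn inferInstance
  have hdec {τ : L ≃ₐ[F] L} (h : ¬ ∃ x, V.v (τ x) ≠ V.v x) (x : L) : V.v (τ x) = V.v x := by
    by_contra h'
    exact h ⟨x, h'⟩
  let D : Finset (L ≃ₐ[F] L) := Finset.univ.filter fun τ => ∀ x, V.v (τ x) = V.v x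
  have ha1 : (1 : L) + a ≠ 0 := by
    intro h
    rw [← eq_neg_iff_add_eq_zero] at h
    rw [← V.v_neg, ← h, V.v_one] at ha
    exact lt_irrefl _ ha
  have ha0 : a ≠ 0 := by rintro rfl; simp [V.v_zero] at ha
  have hva1 : V.v (1 + a) = V.v a := by
    rw [add_comm, V.v_add_eq_left]; rwa [V.v_one]
  let b₀ : L := a * (1 + a)⁻¹
  have hb₀ : 0 < V.v (1 - b₀) := by
    have h1 : 1 - b₀ = (1 + a)⁻¹ := by simp only [b₀]; field_simp; ring
    obtain ⟨r, hr⟩ := WithTop.ne_top_iff_exists.mp (V.v_ne_top _ ha1)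
    rw [h1, V.v_inv_coe hr.symm]
    rw [← hva1, ← hr] at ha
    norm_cast at ha ⊢
    linarith
  have hσb₀ (τ : L ≃ₐ[F] L) (hτ : ∃ x, V.v (τ x) ≠ V.v x) : 0 < V.v (τ b₀) := by
    have h1 : V.v (1 + τ a) = 0 := by
      have := V.v_one_sub_of_pos (x := - τ a) (by rw [V.v_neg]; exact hσa τ hτ)
      simpa using this
    have h2 : V.v (1 + τ a)⁻¹ = 0 := by simpa using V.v_inv_coe (r := 0) (by simpa using h1)
    simp only [b₀, map_mul, map_inv₀, map_add, map_one, V.v_mul, h2, add_zero]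
    exact hσa τ hτ
  let b : L := ∏ d ∈ D, d b₀
  have hD {τ : L ≃ₐ[F] L} : τ ∈ D ↔ ∀ x, V.v (τ x) = V.v x := by simp [D]
  have hbD (τ) (hτ : τ ∈ D) : τ b = b := by
    simp only [b, map_prod]
    refine Finset.prod_bij (fun d _ => τ * d) (fun d hd => ?_) (fun _ _ _ _ h => mul_left_cancel h)
      (fun d hd => ⟨τ⁻¹ * d, ?_, mul_inv_cancel_left _ _⟩) (fun _ _ => rfl)
    · rw [hD] at *
      intro x
      rw [AlgEquiv.mul_apply, hτ, hd]
    · rw [hD] at *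
      intro x
      rw [AlgEquiv.mul_apply, ← hτ, ← hd x]
      congr 1
      exact AlgEquiv.apply_symm_apply τ _
  have hb : 0 < V.v (1 - b) := by
    have : ∀ s ⊆ D, 0 < V.v (1 - ∏ d ∈ s, d b₀) := by
      intro s
      induction s using Finset.induction_on with
      | empty => simp [V.v_zero]
      | insert d s hds ih =>
        intro hs
        have h1 := ih fun x hx => hs (Finset.mem_insert_of_mem hx)
        have hd := hD.mp (hs (Finset.mem_insert_self d s))
        have h2 : 0 < V.v (1 - d b₀) := by
          rw [← map_one d, ← map_sub, hd]; exact hb₀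
        have h3 : V.v (d b₀) = 0 := by
          simpa using V.v_one_sub_of_pos h2
        rw [Finset.prod_insert hds, show 1 - d b₀ * ∏ d ∈ s, d b₀ =
          (1 - d b₀) + d b₀ * (1 - ∏ d ∈ s, d b₀) by ring]
        refine V.lt_v_add h2 ?_
        rw [V.v_mul, h3, zero_add]
        exact h1
    exact this D subset_rfl
  have hσb (τ) (hτ : τ ∉ D) : 0 < V.v (τ b) := by
    have h1 (d) (hd : d ∈ D) : 0 < V.v (τ (d b₀)) := by
      refine hσb₀ (τ * d) ?_
      rw [hD] at hτ hd
      push Not at hτ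
      obtain ⟨x, hx⟩ := hτ
      refine ⟨d⁻¹ x, ?_⟩
      rw [← hd (d⁻¹ x), AlgEquiv.mul_apply]
      convert hx <;> exact AlgEquiv.apply_symm_apply d _
    have h1D : (1 : L ≃ₐ[F] L) ∈ D := hD.mpr fun _ => rfl
    simp only [b, map_prod, V.v_prod]
    rw [← Finset.add_sum_erase _ _ h1D]
    exact add_pos_of_pos_of_nonneg (h1 _ h1D)
      (Finset.sum_nonneg fun d hd => (h1 d (Finset.mem_of_mem_erase hd)).le)
  have hfix := V.fixed_of_henselian hh (Finset.univ.image fun τ : L ≃ₐ[F] L => τ b)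
    (fun τ => by
      ext y
      simp only [Finset.mem_image, Finset.mem_univ, true_and, exists_exists_eq_and]
      constructor
      · rintro ⟨ρ, rfl⟩
        exact ⟨τ * ρ, rfl⟩
      · rintro ⟨ρ, rfl⟩
        exact ⟨τ⁻¹ * ρ, by rw [← AlgEquiv.mul_apply, mul_inv_cancel_left]⟩)
    (b := b) (Finset.mem_image.mpr ⟨1, Finset.mem_univ _, rfl⟩) hb
    (fun y hy hyb => by
      obtain ⟨τ, -, rfl⟩ := Finset.mem_image.mp hy
      exact hσb τ fun h => hyb (hbD τ h))
  by_contra hσ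
  have h1 := hσb σ fun h => hσ (hD.mp h x)
  rw [hfix σ] at h1
  have h2 := V.lt_v_add hb h1
  simp [V.v_one] at h2

end Invariance

open IsLocalRing

/-- The value group of `L^×` is exactly `(1/e)ℤ`. -/
def IsDiscrete {L : Type*} [Field L] (V : AddVal L) (e : ℕ) : Prop :=
  0 < e ∧ (∀ x : L, x ≠ 0 → ∃ k : ℤ, V.v x = (((k : ℝ) / (e : ℝ) : ℝ) : WithTop ℝ)) ∧
    ∃ x : L, V.v x = ((1 / (e : ℝ) : ℝ) : WithTop ℝ)

section Discrete

variable {L : Type*} [Field L] {V : AddVal L} {e : ℕ}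

theorem IsDiscrete.inv_le_of_pos (h : V.IsDiscrete e) {x : L} (hx : 0 < V.v x) :
    ((1 / (e : ℝ) : ℝ) : WithTop ℝ) ≤ V.v x := by
  by_cases hx0 : x = 0
  · simp [hx0, V.v_zero]
  obtain ⟨k, hk⟩ := h.2.1 x hx0
  have he : (0 : ℝ) < e := by exact_mod_cast h.1
  rw [hk] at hx ⊢
  have h1 : (0 : ℝ) < k / e := by exact_mod_cast hx
  have h2 : 1 ≤ k := by
    have : (0 : ℝ) < k := by rwa [div_pos_iff_of_pos_right he] at h1
    exact_mod_cast this
  have h3 : (1 : ℝ) / e ≤ k / e := by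
    gcongr
    exact_mod_cast h2
  exact_mod_cast h3

theorem IsDiscrete.isDiscreteValuationRing (h : V.IsDiscrete e) :
    IsDiscreteValuationRing V.integers := by
  have he : (0 : ℝ) < e := by exact_mod_cast h.1
  obtain ⟨π, hπ⟩ := h.2.2
  have hπpos : (0 : WithTop ℝ) < V.v π := by
    rw [hπ]
    have : (0 : ℝ) < 1 / e := by positivity
    exact_mod_cast this
  let p : V.integers := ⟨π, hπpos.le⟩
  refine IsDiscreteValuationRing.ofHasUnitMulPowIrreducibleFactorization ⟨p, ?_, ?_⟩
  · refine ⟨fun hu => hπpos.ne' ((V.isUnit_integers_iff p).mp hu), fun a b hab => ?_⟩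
    by_contra! hcon
    have ha := h.inv_le_of_pos ((V.mem_maximalIdeal_integers_iff a).mp hcon.1)
    have hb := h.inv_le_of_pos ((V.mem_maximalIdeal_integers_iff b).mp hcon.2)
    have hv : V.v π = V.v (a : L) + V.v (b : L) := by
      rw [← V.v_mul]
      exact congrArg V.v (congrArg Subtype.val hab)
    have h1 := add_le_add ha hb
    rw [← hv, hπ] at h1
    have h2 : (1 : ℝ) / e + 1 / e ≤ 1 / e := by exact_mod_cast h1
    have : (0 : ℝ) < 1 / e := by positivity
    linarith
  · intro x hx
    have hx0 : (x : L) ≠ 0 := fun h0 => hx (Subtype.ext h0)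
    obtain ⟨k, hk⟩ := h.2.1 x hx0
    have hk0 : 0 ≤ k := by
      have h1 : 0 ≤ V.v (x : L) := x.2
      rw [hk] at h1
      have h2 : (0 : ℝ) ≤ k / e := by exact_mod_cast h1
      have h3 : (0 : ℝ) ≤ k := by
        by_contra! h4
        exact absurd h2 (not_le.mpr (div_neg_of_neg_of_pos h4 he))
      exact_mod_cast h3
    lift k to ℕ using hk0
    have hv : V.v ((p ^ k : V.integers) : L) = V.v (x : L) := by
      change V.v (π ^ k) = _
      rw [V.v_pow, hπ, hk, ← WithTop.coe_nsmul, nsmul_eq_mul, mul_one_div]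
      simp
    exact ⟨k, associated_of_dvd_dvd ((V.dvd_integers_iff _ _).mpr hv.le)
      ((V.dvd_integers_iff _ _).mpr hv.ge)⟩

theorem IsDiscrete.mem_maximalIdeal_pow_iff (h : V.IsDiscrete e) (n : ℕ) (x : V.integers) :
    x ∈ maximalIdeal V.integers ^ n ↔ (((n : ℝ) / e : ℝ) : WithTop ℝ) ≤ V.v (x : L) := by
  have he : (0 : ℝ) < e := by exact_mod_cast h.1
  obtain ⟨π, hπ⟩ := h.2.2
  have hπpos : (0 : WithTop ℝ) < V.v π := by
    rw [hπ]
    have : (0 : ℝ) < 1 / e := by positivity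
    exact_mod_cast this
  have hspan : maximalIdeal V.integers = Ideal.span {(⟨π, hπpos.le⟩ : V.integers)} := by
    ext y
    rw [mem_maximalIdeal_integers_iff, Ideal.mem_span_singleton, dvd_integers_iff]
    exact ⟨fun hy => hπ.trans_le (h.inv_le_of_pos hy), fun hy => hπpos.trans_le hy⟩
  rw [hspan, Ideal.span_singleton_pow, Ideal.mem_span_singleton, dvd_integers_iff]
  change V.v (π ^ n) ≤ _ ↔ _
  rw [V.v_pow, hπ, ← WithTop.coe_nsmul, nsmul_eq_mul, mul_one_div]

end Discrete

/-- Invariance of a valuation under a Galois group. -/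
class IsGaloisStable (F : Type*) {L : Type*} [Field F] [Field L] [Algebra F L] (V : AddVal L) :
    Prop where
  v_apply : ∀ (σ : L ≃ₐ[F] L) (x : L), V.v (σ x) = V.v x

section Integers

variable {F L : Type*} [Field F] [Field L] [Algebra F L] (V : AddVal L)

variable (F) in
/-- The valuation induced on a subfield. -/
abbrev base : AddVal F := V.comap (algebraMap F L)

instance : Algebra (V.base F).integers V.integers :=
  (((algebraMap F L).comp (algebraMap (V.base F).integers F)).codRestrict V.integers
    fun x => x.2).toAlgebra

instance : IsScalarTower (V.base F).integers V.integers L := .of_algebraMap_eq fun _ => rfl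

instance : IsLocalHom (algebraMap (V.base F).integers V.integers) where
  map_nonunit a ha := by
    rw [isUnit_integers_iff] at *
    exact ha

instance integersAction [V.IsGaloisStable F] : MulSemiringAction (L ≃ₐ[F] L) V.integers where
  smul σ x := ⟨σ x, by
    rw [mem_integers, IsGaloisStable.v_apply (V := V)]; exact x.2⟩
  one_smul _ := rfl
  mul_smul _ _ _ := rfl
  smul_zero σ := Subtype.ext (map_zero σ)
  smul_add σ x y := Subtype.ext (map_add σ (x : L) y)
  smul_one σ := Subtype.ext (map_one σ)
  smul_mul σ x y := Subtype.ext (map_mul σ (x : L) y)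

instance [V.IsGaloisStable F] [FiniteDimensional F L] [IsGalois F L] :
    IsGaloisGroup (L ≃ₐ[F] L) (V.base F).integers V.integers where
  faithful := ⟨fun {σ τ} h => AlgEquiv.ext fun x => by
    rcases V.integers.mem_or_inv_mem x with hx | hx
    · exact congrArg Subtype.val (h ⟨x, hx⟩)
    · have h1 : σ x⁻¹ = τ x⁻¹ := congrArg Subtype.val (h ⟨x⁻¹, hx⟩)
      simpa using h1⟩
  commutes := ⟨fun σ a x => Subtype.ext (by
    change σ (algebraMap F L a * x) = algebraMap F L a * σ x
    rw [map_mul, AlgEquiv.commutes])⟩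
  isInvariant := ⟨fun x hx => by
    obtain ⟨y, hy⟩ := (IsGalois.mem_range_algebraMap_iff_fixed (x : L)).mpr
      fun σ => congrArg Subtype.val (hx σ)
    refine ⟨⟨y, ?_⟩, Subtype.ext hy⟩
    change 0 ≤ V.v (algebraMap F L y)
    rw [hy]
    exact x.2⟩

theorem isDiscrete_base (hn : V.IsNormalizedOn F) : (V.base F).IsDiscrete 1 :=
  ⟨one_pos, fun x hx => by simpa [comap_v] using hn.1 x hx, by simpa [comap_v] using hn.2⟩

theorem module_finite_integers [V.IsGaloisStable F] [FiniteDimensional F L] [IsGalois F L]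
    (hn : V.IsNormalizedOn F) : Module.Finite (V.base F).integers V.integers := by
  have := (V.isDiscrete_base hn).isDiscreteValuationRing
  have : Algebra.IsIntegral (V.base F).integers V.integers :=
    Algebra.IsInvariant.isIntegral _ _ (L ≃ₐ[F] L)
  have : IsIntegralClosure V.integers (V.base F).integers L :=
    { algebraMap_injective := Subtype.val_injective
      isIntegral_iff := fun {x} => by
        constructor
        · intro hx
          have : IsIntegral V.integers x := hx.tower_top
          exact IsIntegrallyClosed.isIntegral_iff.mp this
        · rintro ⟨y, rfl⟩
          exact (Algebra.IsIntegral.isIntegral y).algebraMap }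
  have : IsScalarTower (V.base F).integers F L := .of_algebraMap_eq fun _ => rfl
  exact IsIntegralClosure.finite (V.base F).integers F L V.integers

theorem perfectField_residueField {V : AddVal L} (hp : V.HasPerfectResidueFieldOn F) :
    PerfectField (ResidueField (V.base F).integers) := by
  obtain ⟨p, hchar⟩ := CharP.exists (ResidueField (V.base F).integers)
  rcases CharP.char_is_prime_or_zero (ResidueField (V.base F).integers) p with hpr | rfl
  · have : Fact p.Prime := ⟨hpr⟩
    have : PerfectRing (ResidueField (V.base F).integers) p := by
      refine PerfectRing.ofSurjective _ p fun x => ?_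
      obtain ⟨x, rfl⟩ := residue_surjective x
      have hp0 : 0 < V.v (algebraMap F L (p : F)) := by
        have h1 : residue _ ((p : ℕ) : (V.base F).integers) = 0 := by
          rw [map_natCast, CharP.cast_eq_zero]
        rw [residue_eq_zero_iff, mem_maximalIdeal_integers_iff] at h1
        exact h1
      obtain ⟨y, hy, hxy⟩ := hp p hpr hp0 x x.2
      refine ⟨residue _ ⟨y, hy⟩, ?_⟩
      rw [frobenius_def, ← map_pow, eq_comm, ← sub_eq_zero, ← map_sub, residue_eq_zero_iff,
        mem_maximalIdeal_integers_iff]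
      exact hxy
    exact PerfectRing.toPerfectField _ p
  · have := CharP.charP_to_charZero (ResidueField (V.base F).integers)
    exact PerfectField.ofCharZero

instance : (maximalIdeal V.integers).LiesOver (maximalIdeal (V.base F).integers) :=
  ⟨Ideal.ext fun a => by
    rw [Ideal.mem_comap, mem_maximalIdeal_integers_iff, mem_maximalIdeal_integers_iff]
    rfl⟩

theorem map_maximalIdeal_ne_bot (hn : V.IsNormalizedOn F) :
    (maximalIdeal (V.base F).integers).map (algebraMap (V.base F).integers V.integers) ≠ ⊥ := by
  obtain ⟨ϖ, hϖ⟩ := hn.2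
  have hpos : 0 < V.v (algebraMap F L ϖ) := by rw [hϖ]; exact_mod_cast one_pos
  intro h
  have h1 := Ideal.mem_map_of_mem (algebraMap (V.base F).integers V.integers)
    (((V.base F).mem_maximalIdeal_integers_iff ⟨ϖ, hpos.le⟩).mpr hpos)
  rw [h, Ideal.mem_bot] at h1
  have h2 : algebraMap F L ϖ = 0 := congrArg Subtype.val h1
  rw [h2, V.v_zero] at hϖ
  exact absurd hϖ (by simp)

/-- The ring of integers is generated by one element over the ring of integers of the base. -/
theorem exists_integral_generator [V.IsGaloisStable F] [FiniteDimensional F L] [IsGalois F L]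
    (hn : V.IsNormalizedOn F) (hp : V.HasPerfectResidueFieldOn F) {e : ℕ} (he : V.IsDiscrete e) :
    ∃ x : L, 0 ≤ V.v x ∧ ∀ y, 0 ≤ V.v y →
      ∃ g : F[X], (∀ n, 0 ≤ V.v (algebraMap F L (g.coeff n))) ∧ y = aeval x g := by
  have := he.isDiscreteValuationRing
  have := (V.isDiscrete_base hn).isDiscreteValuationRing
  have := V.module_finite_integers hn
  have := perfectField_residueField hp
  have : Algebra.IsAlgebraic (ResidueField (V.base F).integers) (ResidueField V.integers) :=
    Algebra.IsAlgebraic.of_finite _ _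
  obtain ⟨x, hx⟩ := exists_adjoin_eq_top_of_isSeparable_residueField (V.map_maximalIdeal_ne_bot hn)
  refine ⟨x, x.2, fun y hy => ?_⟩
  have h1 : (⟨y, hy⟩ : V.integers) ∈ Algebra.adjoin (V.base F).integers {x} := hx ▸ Algebra.mem_top
  rw [Algebra.adjoin_singleton_eq_range_aeval] at h1
  obtain ⟨g, hg⟩ := h1
  refine ⟨g.map (algebraMap _ F), fun n => ?_, ?_⟩
  · rw [coeff_map]
    exact (g.coeff n).2
  · have : IsScalarTower (V.base F).integers F L := .of_algebraMap_eq fun _ => rfl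
    rw [aeval_map_algebraMap]
    have h2 := congrArg (algebraMap V.integers L) hg
    change algebraMap V.integers L (aeval x g) = _ at h2
    rw [← aeval_algebraMap_apply] at h2
    exact h2.symm

/-- The order of the inertia group is the ramification index. -/
theorem card_inertia_eq [V.IsGaloisStable F] [FiniteDimensional F L] [IsGalois F L]
    (hn : V.IsNormalizedOn F) (hp : V.HasPerfectResidueFieldOn F) {e : ℕ} (he : V.IsDiscrete e) :
    Nat.card {σ : L ≃ₐ[F] L // ∀ y, 0 ≤ V.v y → 0 < V.v (σ y - y)} = e := by
  have := he.isDiscreteValuationRing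
  have := (V.isDiscrete_base hn).isDiscreteValuationRing
  have := V.module_finite_integers hn
  have := perfectField_residueField hp
  have : Module.IsTorsionFree (V.base F).integers V.integers := by
    rw [Module.isTorsionFree_iff_algebraMap_injective]
    intro a b hab
    exact Subtype.ext ((algebraMap F L).injective (congrArg Subtype.val hab))
  have : PerfectField (maximalIdeal (V.base F).integers).ResidueField :=
    let f : ResidueField (V.base F).integers →+* (maximalIdeal (V.base F).integers).ResidueField :=
      algebraMap ((V.base F).integers ⧸ maximalIdeal (V.base F).integers) _
    PerfectField.of_ringEquiv (K := ResidueField (V.base F).integers) (RingEquiv.ofBijective f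
      (Ideal.bijective_algebraMap_quotient_residueField (maximalIdeal (V.base F).integers)))
  have h1 := Ideal.card_inertia_eq_ramificationIdxIn (G := L ≃ₐ[F] L)
    (maximalIdeal (V.base F).integers) (maximalIdeal V.integers)
  rw [Ideal.ramificationIdxIn_eq_ramificationIdx _ (maximalIdeal V.integers) (L ≃ₐ[F] L),
    ← Ideal.ramificationIdx'_eq_ramificationIdx' (maximalIdeal (V.base F).integers) _
      (V.map_maximalIdeal_ne_bot hn)] at h1
  rw [Ideal.ramificationIdx'_spec (n := e)] at h1
  · rw [← h1]
    refine Nat.card_congr (Equiv.subtypeEquivRight fun σ => ?_)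
    refine ⟨fun h x => ?_, fun h y hy => ?_⟩
    · exact (V.mem_maximalIdeal_integers_iff (σ • x - x)).mpr (h x x.2)
    · exact (V.mem_maximalIdeal_integers_iff (σ • (⟨y, hy⟩ : V.integers) - ⟨y, hy⟩)).mp (h ⟨y, hy⟩)
  · rw [Ideal.map_le_iff_le_comap]
    intro a ha
    rw [Ideal.mem_comap, he.mem_maximalIdeal_pow_iff]
    have h2 := (V.isDiscrete_base hn).inv_le_of_pos (((V.base F).mem_maximalIdeal_integers_iff a).mp ha)
    have h3 : ((e : ℝ) / e) = 1 / (1 : ℕ) := by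
      have : (e : ℝ) ≠ 0 := by exact_mod_cast he.1.ne'
      simp [this]
    rw [h3]
    exact h2
  · intro hle
    obtain ⟨ϖ, hϖ⟩ := hn.2
    have hpos : 0 < V.v (algebraMap F L ϖ) := by rw [hϖ]; exact_mod_cast one_pos
    have h2 := hle (Ideal.mem_map_of_mem _
      (((V.base F).mem_maximalIdeal_integers_iff ⟨ϖ, hpos.le⟩).mpr hpos))
    rw [he.mem_maximalIdeal_pow_iff] at h2
    change _ ≤ V.v (algebraMap F L ϖ) at h2
    rw [hϖ] at h2
    have h3 : ((e + 1 : ℕ) : ℝ) / e ≤ 1 := by exact_mod_cast h2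
    have h4 : (0 : ℝ) < e := by exact_mod_cast he.1
    rw [div_le_one h4] at h3
    push_cast at h3
    linarith

end Integers

section Discreteness

variable {F L : Type*} [Field F] [Field L] [Algebra F L] [FiniteDimensional F L] [IsGalois F L]

theorem exists_isDiscrete (V : AddVal L) [V.IsGaloisStable F] (hn : V.IsNormalizedOn F) :
    ∃ e, V.IsDiscrete e := by
  let n := Fintype.card (L ≃ₐ[F] L)
  have hn0 : (n : ℝ) ≠ 0 := by exact_mod_cast Fintype.card_ne_zero
  have hint (x : L) (hx : x ≠ 0) : ∃ k : ℤ, V.v x = (((k : ℝ) / n : ℝ) : WithTop ℝ) := by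
    obtain ⟨a, ha⟩ := (IsGalois.mem_range_algebraMap_iff_fixed (∏ σ : L ≃ₐ[F] L, σ x)).mpr
      fun τ => by
        rw [map_prod]
        exact Fintype.prod_equiv (Equiv.mulLeft τ) _ _ fun _ => rfl
    have ha0 : a ≠ 0 := by
      rintro rfl
      rw [map_zero, eq_comm, Finset.prod_eq_zero_iff] at ha
      obtain ⟨σ, -, h⟩ := ha
      exact hx (by simpa using h)
    obtain ⟨k, hk⟩ := hn.1 a ha0
    refine ⟨k, ?_⟩
    obtain ⟨r, hr⟩ := WithTop.ne_top_iff_exists.mp (V.v_ne_top x hx)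
    rw [ha, V.v_prod] at hk
    simp only [IsGaloisStable.v_apply (V := V), Finset.sum_const, ← hr, Finset.card_univ,
      ← WithTop.coe_nsmul, nsmul_eq_mul] at hk
    have hk' : (n : ℝ) * r = k := by exact_mod_cast hk
    rw [← hr, ← hk', mul_div_cancel_left₀ _ hn0]
  let S : AddSubgroup ℤ :=
    { carrier := {k | ∃ x : L, V.v x = (((k : ℝ) / n : ℝ) : WithTop ℝ)}
      zero_mem' := ⟨1, by simp [V.v_one]⟩
      add_mem' := by
        rintro k l ⟨x, hx⟩ ⟨y, hy⟩
        refine ⟨x * y, ?_⟩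
        rw [V.v_mul, hx, hy, ← WithTop.coe_add]
        congr 1
        push_cast
        rw [add_div]
      neg_mem' := by
        rintro k ⟨x, hx⟩
        refine ⟨x⁻¹, ?_⟩
        rw [V.v_inv_coe hx]
        congr 1
        push_cast
        rw [neg_div] }
  obtain ⟨d, hd⟩ := Int.subgroup_cyclic S
  have hS (k : ℤ) : k ∈ S ↔ d ∣ k := by
    rw [hd, AddSubgroup.mem_closure_singleton, dvd_iff_exists_eq_mul_left]
    simp [eq_comm]
  have hnS : (n : ℤ) ∈ S := by
    obtain ⟨ϖ, hϖ⟩ := hn.2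
    refine ⟨algebraMap F L ϖ, ?_⟩
    rw [hϖ]
    simp [hn0]
  obtain ⟨m, hm⟩ := (hS _).mp hnS
  have hm0 : (m : ℝ) ≠ 0 := by
    rintro h
    have : m = 0 := by exact_mod_cast h
    rw [this] at hm
    simp only [mul_zero] at hm
    exact hn0 (by exact_mod_cast hm)
  have hd0 : (d : ℝ) ≠ 0 := by
    rintro h
    have : d = 0 := by exact_mod_cast h
    rw [this] at hm
    simp only [zero_mul] at hm
    exact hn0 (by exact_mod_cast hm)
  have hmR : (n : ℝ) = d * m := by exact_mod_cast hm
  have hdS : ∃ x : L, V.v x = ((1 / (m : ℝ) : ℝ) : WithTop ℝ) := by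
    obtain ⟨x, hx⟩ := (hS d).mpr dvd_rfl
    refine ⟨x, ?_⟩
    rw [hx, hmR]
    congr 1
    field_simp
  have habs : ((m.natAbs : ℕ) : ℝ) = |(m : ℝ)| := by
    rw [← Int.cast_abs, Int.abs_eq_natAbs]
    simp
  refine ⟨m.natAbs, Int.natAbs_pos.mpr (by exact_mod_cast hm0), fun x hx => ?_, ?_⟩
  · obtain ⟨k, hk⟩ := hint x hx
    obtain ⟨l, rfl⟩ := (hS k).mp ⟨x, hk⟩
    rw [hk, hmR, habs]
    rcases abs_choice (m : ℝ) with h | h <;> rw [h]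
    · refine ⟨l, ?_⟩
      congr 1
      push_cast
      field_simp
    · refine ⟨-l, ?_⟩
      congr 1
      push_cast
      field_simp
  · rw [habs]
    obtain ⟨x, hx⟩ := hdS
    rcases abs_choice (m : ℝ) with h | h <;> rw [h]
    · exact ⟨x, hx⟩
    · refine ⟨x⁻¹, ?_⟩
      rw [V.v_inv_coe hx]
      congr 1
      field_simp

end Discreteness

section Generator

variable {F L : Type*} [Field F] [Field L] [Algebra F L]

variable (F) in
/-- The element `x` generates the ring of integers of `L` over the ring of integers of `F`. -/
def IsGenerator (V : AddVal L) (x : L) : Prop :=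
  0 ≤ V.v x ∧ ∀ y, 0 ≤ V.v y →
    ∃ g : F[X], (∀ n, 0 ≤ V.v (algebraMap F L (g.coeff n))) ∧ y = aeval x g

theorem sum_v_sub_le_v_eval (V : AddVal L) {x : L} (hx : 0 ≤ V.v x) (s : Finset L) :
    ∀ p : L[X], (∀ n, 0 ≤ V.v (p.coeff n)) → (∀ t ∈ s, 0 ≤ V.v t ∧ p.IsRoot t) →
      ∑ t ∈ s, V.v (x - t) ≤ V.v (p.eval x) := by
  induction s using Finset.induction_on with
  | empty => exact fun p hp _ => by simpa using V.v_eval_nonneg hp hx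
  | insert t s hts ih =>
    intro p hp hs
    obtain ⟨ht, hroot⟩ := hs t (Finset.mem_insert_self t s)
    have hfac := mul_divByMonic_eq_iff_isRoot.mpr hroot
    have heval (y : L) : p.eval y = (y - t) * (p /ₘ (X - C t)).eval y := by
      conv_lhs => rw [← hfac]
      simp
    rw [Finset.sum_insert hts, heval, V.v_mul]
    gcongr
    refine ih _ (fun n => ?_) fun u hu => ?_
    · rw [coeff_divByMonic_X_sub_C]
      exact sum_mem (S := V.integers) fun i _ => V.integers.mul_mem _ _ (pow_mem ht _) (hp i)
    · obtain ⟨hu0, hur⟩ := hs u (Finset.mem_insert_of_mem hu)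
      refine ⟨hu0, ?_⟩
      rw [IsRoot.def, heval] at hur
      refine (mul_eq_zero.mp hur).resolve_left fun h => hts ?_
      rwa [← sub_eq_zero.mp h]

theorem IsGenerator.ext {V : AddVal L} {x : L} (hx : V.IsGenerator F x) {σ τ : L ≃ₐ[F] L}
    (h : σ x = τ x) : σ = τ := by
  have key (y : L) (hy : 0 ≤ V.v y) : σ y = τ y := by
    obtain ⟨g, -, rfl⟩ := hx.2 y hy
    rw [← aeval_algHom_apply, ← aeval_algHom_apply, h]
  refine AlgEquiv.ext fun y => ?_
  rcases V.integers.mem_or_inv_mem y with hy | hy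
  · exact key y hy
  · simpa using key _ hy

theorem IsGenerator.sum_le {V : AddVal L} [V.IsGaloisStable F] {x : L} (hx : V.IsGenerator F x)
    {y z : L} (hy : 0 ≤ V.v y) (hz : 0 ≤ V.v z) {ι : Type*} (s : Finset ι) (f : ι → L ≃ₐ[F] L)
    (hf : Function.Injective f) (hs : ∀ i ∈ s, f i y = z) :
    ∑ i ∈ s, V.v (f i x - x) ≤ V.v (z - y) := by
  obtain ⟨g, hg, rfl⟩ := hx.2 y hy
  have := V.sum_v_sub_le_v_eval hx.1 (s.image fun i => f i x) (g.map (algebraMap F L) - C z)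
    (fun n => ?_) ?_
  · rw [Finset.sum_image fun i _ j _ h => hf (hx.ext h)] at this
    simpa [V.v_sub_comm, eval_map_algebraMap] using this
  · rw [coeff_sub, coeff_map]
    refine V.le_v_sub (hg n) ?_
    rw [coeff_C]
    split_ifs
    · exact hz
    · simp [V.v_zero]
  · intro t ht
    obtain ⟨i, hi, rfl⟩ := Finset.mem_image.mp ht
    refine ⟨by rw [IsGaloisStable.v_apply (V := V)]; exact hx.1, ?_⟩
    rw [IsRoot.def, eval_sub, eval_C, eval_map_algebraMap, aeval_algHom_apply, hs i hi, sub_self]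

end Generator

section Tower

variable {F M L : Type*} [Field F] [Field M] [Field L] [Algebra F M] [Algebra M L] [Algebra F L]
  [IsScalarTower F M L] {V : AddVal L}

/-- A generator of the ring of integers realizes the minimal displacement of an embedding. -/
theorem IsGenerator.v_sub_le {y : M} (hy : (V.base M).IsGenerator F y) (σ : M →ₐ[F] L)
    (hσ : 0 ≤ V.v (σ y)) {c : M} (hc : 0 ≤ V.v (algebraMap M L c)) :
    V.v (σ y - algebraMap M L y) ≤ V.v (σ c - algebraMap M L c) := by
  obtain ⟨g, hg, rfl⟩ := hy.2 c hc
  have := V.sum_v_sub_le_v_eval hσ {algebraMap M L y}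
    (g.map (algebraMap F L) - C (algebraMap M L (aeval y g))) (fun n => ?_) ?_
  · simpa [eval_map_algebraMap, aeval_algHom_apply] using this
  · rw [coeff_sub, coeff_map, coeff_C]
    refine V.le_v_sub ?_ ?_
    · simpa [comap_v, ← IsScalarTower.algebraMap_apply F M L] using hg n
    · split_ifs
      · exact hc
      · simp [V.v_zero]
  · intro t ht
    obtain rfl := Finset.mem_singleton.mp ht
    refine ⟨hy.1, ?_⟩
    rw [IsRoot.def, eval_sub, eval_C, eval_map_algebraMap, aeval_algebraMap_apply, sub_self]

variable [V.IsGaloisStable F]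

/-- The displacement of the restriction to `M` is the sum of the displacements over the fibre. -/
theorem IsGenerator.v_restrict_eq_sum {x : L} (hx : V.IsGenerator F x) {y : M}
    (hy : (V.base M).IsGenerator F y) [FiniteDimensional M L] [IsGalois M L] (σ : L ≃ₐ[F] L) :
    V.v (σ (algebraMap M L y) - algebraMap M L y) =
      ∑ h : L ≃ₐ[M] L, V.v (σ (h x) - x) := by
  have hy0 : 0 ≤ V.v (algebraMap M L y) := hy.1
  refine le_antisymm ?_ ?_
  · set f : L[X] := ∏ h : L ≃ₐ[M] L, (X - C (h x)) with hf
    have hx' (h : L ≃ₐ[M] L) : 0 ≤ V.v (h x) := by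
      have := IsGaloisStable.v_apply (V := V) (h.restrictScalars F) x
      exact this ▸ hx.1
    have hfM (n : ℕ) : f.coeff n ∈ Set.range (algebraMap M L) := by
      rw [IsGalois.mem_range_algebraMap_iff_fixed]
      intro τ
      have : f.map (τ : L →+* L) = f := by
        rw [hf, Polynomial.map_prod]
        refine Fintype.prod_equiv (Equiv.mulLeft τ) _ _ fun h => ?_
        simp
      conv_rhs => rw [← this, coeff_map]
      rfl
    have hf0 (n : ℕ) : 0 ≤ V.v (f.coeff n) :=
      V.v_coeff_nonneg_of_mem_lifts (V.prod_X_sub_C_mem_lifts Finset.univ _ fun h _ => hx' h) n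
    have hfx : f.eval x = 0 := by
      rw [hf, eval_prod]
      exact Finset.prod_eq_zero (Finset.mem_univ 1) (by simp)
    have hσf : (f.map (σ : L →+* L) - f).eval x = ∏ h : L ≃ₐ[M] L, (x - σ (h x)) := by
      rw [eval_sub, hfx, sub_zero, hf, Polynomial.map_prod, eval_prod]
      simp
    have hle : V.v (σ (algebraMap M L y) - algebraMap M L y) ≤
        V.v ((f.map (σ : L →+* L) - f).eval x) := by
      rw [eval_eq_sum_range]
      refine V.le_v_sum _ _ fun n _ => ?_
      rw [V.v_mul, coeff_sub, coeff_map]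
      refine le_add_of_le_of_nonneg ?_ (pow_mem (S := V.integers) hx.1 n)
      obtain ⟨c, hc⟩ := hfM n
      have := hy.v_sub_le ((σ : L →ₐ[F] L).comp (IsScalarTower.toAlgHom F M L))
        (by simpa [IsGaloisStable.v_apply (V := V)] using hy0) (c := c) (by rw [hc]; exact hf0 n)
      simpa [hc] using this
    refine hle.trans_eq ?_
    rw [hσf, V.v_prod]
    exact Finset.sum_congr rfl fun h _ => V.v_sub_comm _ _
  · refine hx.sum_le hy0 (by simpa [IsGaloisStable.v_apply (V := V)] using hy0) Finset.univ
      (fun h : L ≃ₐ[M] L => σ * h.restrictScalars F) (fun h h' hh => ?_) (fun h _ => ?_)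
    · exact AlgEquiv.restrictScalars_injective F (mul_left_cancel hh)
    · simp

end Tower

section Displacement

variable {F L : Type*} [Field F] [Field L] [Algebra F L] (V : AddVal L) [V.IsGaloisStable F]

theorem min_v_sub_le_v_mul_sub (x : L) (σ τ : L ≃ₐ[F] L) :
    min (V.v (σ x - x)) (V.v (τ x - x)) ≤ V.v ((σ * τ) x - x) := by
  have h : (σ * τ) x - x = (σ x - x) + σ (τ x - x) := by
    rw [AlgEquiv.mul_apply, map_sub]
    ring
  rw [h]
  refine (V.v_min_le_add _ _).trans' (le_of_eq ?_)
  rw [IsGaloisStable.v_apply (V := V)]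

theorem v_inv_sub (x : L) (σ : L ≃ₐ[F] L) : V.v (σ⁻¹ x - x) = V.v (σ x - x) := by
  rw [← IsGaloisStable.v_apply (V := V) σ (σ⁻¹ x - x), map_sub, ← AlgEquiv.mul_apply,
    mul_inv_cancel, AlgEquiv.one_apply, V.v_sub_comm]

theorem v_mul_sub_eq_min {x : L} {σ τ : L ≃ₐ[F] L}
    (h : V.v ((σ * τ) x - x) ≤ V.v (σ x - x)) :
    V.v ((σ * τ) x - x) = min (V.v (σ x - x)) (V.v (τ x - x)) := by
  refine le_antisymm (le_min h ?_) (V.min_v_sub_le_v_mul_sub x σ τ)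
  have := V.min_v_sub_le_v_mul_sub x σ⁻¹ (σ * τ)
  rw [inv_mul_cancel_left, V.v_inv_sub, min_eq_right h] at this
  exact this

variable (F) in
/-- The transition function `a ↦ ∑ σ, min (v (σ x - x)) a` of a finite extension. -/
def transition (V : AddVal L) [FiniteDimensional F L] (x : L) (a : WithTop ℝ) : WithTop ℝ :=
  ∑ σ : L ≃ₐ[F] L, min (V.v (σ x - x)) a

variable [FiniteDimensional F L]

variable (F) in
theorem monotone_transition (V : AddVal L) (x : L) : Monotone (V.transition F x) :=
  fun _ _ h => Finset.sum_le_sum fun _ _ => min_le_min le_rfl h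

theorem transition_eq_add (V : AddVal L) (x : L) (a : WithTop ℝ) :
    V.transition F x a =
      a + ∑ σ ∈ Finset.univ.erase (1 : L ≃ₐ[F] L), min (V.v (σ x - x)) a := by
  rw [transition, ← Finset.add_sum_erase _ _ (Finset.mem_univ 1)]
  simp [V.v_zero]

theorem le_of_transition_le (V : AddVal L) {x : L}
    {a b : WithTop ℝ} (h : V.transition F x a ≤ V.transition F x b) : a ≤ b := by
  by_contra! hlt
  refine h.not_gt ?_
  rw [transition_eq_add, transition_eq_add]
  refine WithTop.add_lt_add_of_lt_of_le ?_ hlt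
    (Finset.sum_le_sum fun σ _ => min_le_min le_rfl hlt.le)
  refine WithTop.sum_ne_top.mpr fun σ hσ => ?_
  exact ((min_le_right _ _).trans_lt (hlt.trans_le le_top)).ne

end Displacement

section Composition

variable {F M L : Type*} [Field F] [Field M] [Field L] [Algebra F M] [Algebra M L] [Algebra F L]
  [IsScalarTower F M L] {V : AddVal L} [V.IsGaloisStable F]

theorem exists_v_mul_sub_eq_min [FiniteDimensional M L] (V : AddVal L) [V.IsGaloisStable F]
    (x : L) (σ : L ≃ₐ[F] L) :
    ∃ h₀ : L ≃ₐ[M] L, ∀ h : L ≃ₐ[M] L,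
      V.v (σ (h₀ (h x)) - x) = min (V.v (σ (h₀ x) - x)) (V.v (h x - x)) := by
  obtain ⟨h₀, hmax⟩ := Finite.exists_max fun h : L ≃ₐ[M] L => V.v (σ (h x) - x)
  exact ⟨h₀, fun h => V.v_mul_sub_eq_min (σ := σ * h₀.restrictScalars F)
    (τ := h.restrictScalars F) (hmax (h₀ * h))⟩

variable [FiniteDimensional M L] [IsGalois M L] {x : L} {y : M}

theorem IsGenerator.exists_lift (hx : V.IsGenerator F x) (hy : (V.base M).IsGenerator F y)
    (σ : L ≃ₐ[F] L) :
    ∃ h₀ : L ≃ₐ[M] L, (∀ h : L ≃ₐ[M] L, V.v (σ (h x) - x) ≤ V.v (σ (h₀ x) - x)) ∧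
      V.v (σ (algebraMap M L y) - algebraMap M L y) =
        V.transition M x (V.v (σ (h₀ x) - x)) ∧
      ∀ a, ∑ h : L ≃ₐ[M] L, min (V.v (σ (h x) - x)) a =
        V.transition M x (min (V.v (σ (h₀ x) - x)) a) := by
  obtain ⟨h₀, hh₀⟩ := V.exists_v_mul_sub_eq_min (M := M) x σ
  have hsum (a : WithTop ℝ) : ∑ h : L ≃ₐ[M] L, min (V.v (σ (h x) - x)) a =
        V.transition M x (min (V.v (σ (h₀ x) - x)) a) := by
    rw [transition, ← Equiv.sum_comp (Equiv.mulLeft h₀)]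
    refine Finset.sum_congr rfl fun h _ => ?_
    rw [Equiv.coe_mulLeft, AlgEquiv.mul_apply, hh₀, min_comm (V.v _) (V.v (h x - x)), min_assoc]
  refine ⟨h₀, fun h => ?_, ?_, hsum⟩
  · have := hh₀ (h₀⁻¹ * h)
    rw [← AlgEquiv.mul_apply h₀, mul_inv_cancel_left] at this
    exact this.trans_le (min_le_left _ _)
  · simpa [hx.v_restrict_eq_sum hy] using hsum ⊤

theorem IsGenerator.sum_min_eq (hx : V.IsGenerator F x) (hy : (V.base M).IsGenerator F y)
    (σ : L ≃ₐ[F] L) (a : WithTop ℝ) :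
    ∑ h : L ≃ₐ[M] L, min (V.v (σ (h x) - x)) a =
      min (V.v (σ (algebraMap M L y) - algebraMap M L y)) (V.transition M x a) := by
  obtain ⟨h₀, -, h₁, h₂⟩ := hx.exists_lift hy σ
  rw [h₂, h₁, (V.monotone_transition M x).map_min]

theorem sum_galois_tower [FiniteDimensional F L] [FiniteDimensional F M] [IsGalois F L]
    [IsGalois F M] {A : Type*} [AddCommMonoid A] (s : (M ≃ₐ[F] M) → (L ≃ₐ[F] L))
    (hs : ∀ τ y, s τ (algebraMap M L y) = algebraMap M L (τ y)) (f : (L ≃ₐ[F] L) → A) :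
    ∑ σ, f σ = ∑ τ, ∑ h : L ≃ₐ[M] L, f (s τ * h.restrictScalars F) := by
  rw [← Fintype.sum_prod_type']
  refine (Function.Bijective.sum_comp
    (e := fun p : (M ≃ₐ[F] M) × (L ≃ₐ[M] L) => s p.1 * p.2.restrictScalars F) ?_ f).symm
  rw [Fintype.bijective_iff_injective_and_card]
  constructor
  · rintro ⟨τ, h⟩ ⟨τ', h'⟩ he
    obtain rfl : τ = τ' := by
      refine AlgEquiv.ext fun y => (algebraMap M L).injective ?_
      simpa [hs] using DFunLike.congr_fun he (algebraMap M L y)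
    exact Prod.ext rfl (AlgEquiv.restrictScalars_injective F (mul_left_cancel he))
  · rw [Fintype.card_prod, ← Nat.card_eq_fintype_card, ← Nat.card_eq_fintype_card,
      ← Nat.card_eq_fintype_card, IsGalois.card_aut_eq_finrank, IsGalois.card_aut_eq_finrank,
      IsGalois.card_aut_eq_finrank, Module.finrank_mul_finrank]

theorem IsGenerator.transition_comp [FiniteDimensional F L] [FiniteDimensional F M]
    [IsGalois F L] [IsGalois F M] (hx : V.IsGenerator F x) (hy : (V.base M).IsGenerator F y)
    (a : WithTop ℝ) :
    V.transition F x a = (V.base M).transition F y (V.transition M x a) := by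
  obtain ⟨s, hs⟩ := (AlgEquiv.restrictNormalHom_surjective (F := F) (K₁ := M) L).hasRightInverse
  have hs' (τ : M ≃ₐ[F] M) (y : M) : s τ (algebraMap M L y) = algebraMap M L (τ y) := by
    conv_rhs => rw [← hs τ]
    exact (AlgEquiv.restrictNormal_commutes (s τ) M y).symm
  rw [transition, sum_galois_tower s hs', transition]
  refine Finset.sum_congr rfl fun τ _ => ?_
  simp only [AlgEquiv.mul_apply, AlgEquiv.restrictScalars_apply]
  rw [hx.sum_min_eq hy, hs', comap_v, map_sub]

end Composition

section Herbrand

theorem intervalIntegrable_threshold (e : ℕ) (i : WithTop ℝ) (s : ℝ) :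
    IntervalIntegrable (fun t : ℝ => if (((t + 1) / e : ℝ) : WithTop ℝ) ≤ i then (1 : ℝ) else 0)
      MeasureTheory.volume 0 s := by
  refine Antitone.intervalIntegrable fun t u htu => ?_
  have h : (((t + 1) / e : ℝ) : WithTop ℝ) ≤ ((u + 1) / e : ℝ) := by
    rw [WithTop.coe_le_coe]
    gcongr
  by_cases hu : (((u + 1) / e : ℝ) : WithTop ℝ) ≤ i
  · rw [if_pos hu, if_pos (h.trans hu)]
  · rw [if_neg hu]
    split_ifs <;> norm_num

theorem integral_threshold {e : ℕ} (he : 0 < e) {i : WithTop ℝ}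
    (hi : i = 0 ∨ ((1 / e : ℝ) : WithTop ℝ) ≤ i) {s : ℝ} (hs : 0 ≤ s) :
    (∫ t in (0 : ℝ)..s, if (((t + 1) / e : ℝ) : WithTop ℝ) ≤ i then (1 : ℝ) else 0) +
        (if ((1 / e : ℝ) : WithTop ℝ) ≤ i then 1 else 0) =
      e * (min i ((s + 1) / e : ℝ)).untopD 0 := by
  have he' : (0 : ℝ) < e := by exact_mod_cast he
  induction i with
  | top =>
    simp
    field_simp
  | coe i =>
    have hfun : (fun t : ℝ => if (((t + 1) / e : ℝ) : WithTop ℝ) ≤ i then (1 : ℝ) else 0) =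
        (Set.Iic (e * i - 1)).indicator fun _ => 1 := by
      funext t
      rw [Set.indicator_apply]
      refine if_congr ?_ rfl rfl
      rw [WithTop.coe_le_coe, div_le_iff₀ he', Set.mem_Iic, le_sub_iff_add_le, mul_comm]
    rw [hfun, intervalIntegral.integral_of_le hs, MeasureTheory.setIntegral_indicator
      measurableSet_Iic, Set.Ioc_inter_Iic, MeasureTheory.setIntegral_const,
      Real.volume_real_Ioc, ← WithTop.coe_min, WithTop.untopD_coe, sub_zero, smul_eq_mul, mul_one,
      mul_min_of_nonneg _ _ he'.le, mul_div_cancel₀ _ he'.ne']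
    simp only [WithTop.coe_le_coe, div_le_iff₀ he'] at hi ⊢
    rcases hi with hi | hi
    · obtain rfl : i = 0 := by exact_mod_cast hi
      have h1 : ¬ (1 : ℝ) ≤ 0 * e := by norm_num
      rw [if_neg h1, mul_zero, min_eq_left (by positivity : (0 : ℝ) ≤ s + 1)]
      rw [min_eq_right (by linarith), max_eq_right (by norm_num), add_zero]
    · rw [if_pos hi, max_eq_left (le_min hs (by linarith)), ← min_add_add_right, min_comm,
        sub_add_cancel]

variable {F Ω : Type*} [Field F] [Field Ω] [Algebra F Ω] {V : AddVal Ω}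
  {M : IntermediateField F Ω} {y : M}

theorem IsGenerator.xiRel_iff (hy : (V.base M).IsGenerator F y) {e : ℕ} {s : ℝ}
    {σ : M →ₐ[F] Ω} (hσ : 0 ≤ V.v (σ y)) :
    xiRel V M e s σ M.val ↔ (((s + 1) / e : ℝ) : WithTop ℝ) ≤ V.v (σ y - y) :=
  ⟨fun h => h y hy.1, fun h _ hc => h.trans (hy.v_sub_le σ hσ hc)⟩

variable [(V.base M).IsGaloisStable F]

theorem IsGenerator.xiRel_algEquiv_iff (hy : (V.base M).IsGenerator F y) {e : ℕ} {s : ℝ}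
    (τ : M ≃ₐ[F] M) :
    xiRel V M e s (M.val.comp τ) M.val ↔
      (((s + 1) / e : ℝ) : WithTop ℝ) ≤ (V.base M).v (τ y - y) :=
  hy.xiRel_iff (σ := M.val.comp τ)
    ((IsGaloisStable.v_apply (V := V.base M) τ y).symm ▸ hy.1 : 0 ≤ (V.base M).v (τ y))

variable [IsGalois F M]

theorem IsGenerator.gfun_eq (hy : (V.base M).IsGenerator F y) (e : ℕ) (t : ℝ) :
    gfun V M e t = Nat.card
      {τ : M ≃ₐ[F] M // (((t + 1) / e : ℝ) : WithTop ℝ) ≤ (V.base M).v (τ y - y)} :=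
  (Nat.card_congr ((Normal.algHomEquivAut F Ω M).symm.subtypeEquiv
    fun τ => (hy.xiRel_algEquiv_iff τ).symm)).symm

variable [FiniteDimensional F M]

/-- The Herbrand function as a transition function, up to the usual change of coordinates. -/
theorem IsGenerator.herbrand_add_one (hy : (V.base M).IsGenerator F y)
    (hn : V.IsNormalizedOn F) (hp : V.HasPerfectResidueFieldOn F) {e : ℕ} (he : V.IsRamIdx M e)
    {s : ℝ} (hs : 0 ≤ s) :
    ((herbrand V M e s + 1 : ℝ) : WithTop ℝ) =
      (V.base M).transition F y ((s + 1) / e : ℝ) := by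
  have hd : (V.base M).IsDiscrete e := he
  have he0 : (0 : ℝ) < e := by exact_mod_cast he.1
  set i : (M ≃ₐ[F] M) → WithTop ℝ := fun τ => (V.base M).v (τ y - y) with hi
  have hg (t : ℝ) : (gfun V M e t : ℝ) =
      ∑ τ, if (((t + 1) / e : ℝ) : WithTop ℝ) ≤ i τ then (1 : ℝ) else 0 := by
    rw [hy.gfun_eq, Nat.card_eq_fintype_card, Fintype.card_subtype, Finset.sum_boole]
  have hi0 (τ) : 0 ≤ i τ :=
    (V.base M).le_v_sub (by rw [IsGaloisStable.v_apply (V := V.base M)]; exact hy.1) hy.1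
  have hi1 (τ) : i τ = 0 ∨ ((1 / e : ℝ) : WithTop ℝ) ≤ i τ :=
    (hi0 τ).eq_or_lt.imp Eq.symm hd.inv_le_of_pos
  have hg0 : gfun V M e 0 = e := by
    rw [hy.gfun_eq]
    refine (Nat.card_congr (Equiv.subtypeEquivRight fun τ => ?_)).trans
      ((V.base M).card_inertia_eq (F := F) hn hp hd)
    rw [← hy.xiRel_algEquiv_iff]
    refine ⟨fun h c hc => lt_of_lt_of_le ?_ (h c hc), fun h c hc => ?_⟩
    · rw [zero_add]
      exact_mod_cast one_div_pos.mpr he0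
    · rw [zero_add]
      exact hd.inv_le_of_pos (h c hc)
  have hmin (τ) : min (i τ) ((s + 1) / e : ℝ) =
      (((min (i τ) ((s + 1) / e : ℝ)).untopD 0 : ℝ) : WithTop ℝ) := by
    obtain ⟨c, hc⟩ := WithTop.ne_top_iff_exists.mp
      ((min_le_right (i τ) (((s + 1) / e : ℝ) : WithTop ℝ)).trans_lt (WithTop.coe_lt_top _)).ne
    rw [← hc, WithTop.untopD_coe]
  rw [transition, Finset.sum_congr rfl fun τ _ => hmin τ, ← WithTop.coe_sum]
  congr 1
  refine mul_left_cancel₀ he0.ne' ?_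
  have h1 : herbrand V M e s =
      (∑ τ, ∫ t in (0 : ℝ)..s, if (((t + 1) / e : ℝ) : WithTop ℝ) ≤ i τ then (1 : ℝ) else 0) / e := by
    rw [herbrand, intervalIntegral.integral_div, hg0]
    simp only [hg]
    rw [intervalIntegral.integral_finsetSum fun τ _ => intervalIntegrable_threshold e (i τ) s]
  have h2 : (e : ℝ) = ∑ τ, if ((1 / e : ℝ) : WithTop ℝ) ≤ i τ then (1 : ℝ) else 0 := by
    have := hg 0
    rwa [hg0, zero_add] at this
  rw [Finset.mul_sum, ← Finset.sum_congr rfl fun τ _ => integral_threshold he.1 (hi1 τ) hs,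
    Finset.sum_add_distrib, ← h2, h1]
  field_simp

end Herbrand

theorem exists_transition_eq {F L : Type*} [Field F] [Field L] [Algebra F L]
    [FiniteDimensional F L] (V : AddVal L) {x : L} (hx : ∀ σ : L ≃ₐ[F] L, 0 ≤ V.v (σ x - x))
    {c : ℝ} (hc : 0 ≤ c) : ∃ a : ℝ, V.transition F x a = c := by
  set f : (L ≃ₐ[F] L) → ℝ → ℝ := fun σ a => (min (V.v (σ x - x)) a).untopD 0 with hf
  have hfc (σ) (a : ℝ) : min (V.v (σ x - x)) a = (f σ a : WithTop ℝ) := by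
    obtain ⟨b, hb⟩ := WithTop.ne_top_iff_exists.mp
      ((min_le_right (V.v (σ x - x)) (a : WithTop ℝ)).trans_lt (WithTop.coe_lt_top _)).ne
    rw [hf]
    dsimp only
    rw [← hb, WithTop.untopD_coe]
  have hsum (a : ℝ) : V.transition F x a = ((∑ σ, f σ a : ℝ) : WithTop ℝ) := by
    rw [transition, WithTop.coe_sum]
    exact Finset.sum_congr rfl fun σ _ => hfc σ a
  have hcont : Continuous fun a => ∑ σ, f σ a := by
    refine continuous_finsetSum _ fun σ _ => ?_
    rw [hf]
    dsimp only
    cases V.v (σ x - x) with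
    | top => simpa using continuous_id'
    | coe b =>
      simp only [← WithTop.coe_min, WithTop.untopD_coe]
      exact continuous_const.min continuous_id
  have h0 : ∑ σ, f σ 0 ≤ c := by
    refine (Finset.sum_nonpos fun σ _ => ?_).trans hc
    rw [← WithTop.coe_le_coe, ← hfc]
    exact min_le_right _ _
  have h1 : c ≤ ∑ σ, f σ c := by
    refine le_trans (le_of_eq ?_) (Finset.single_le_sum (f := fun σ => f σ c) (fun σ _ => ?_)
      (Finset.mem_univ 1))
    · rw [← WithTop.coe_inj, ← hfc]
      simp [V.v_zero]
    · rw [← WithTop.coe_le_coe, ← hfc]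
      exact le_min (hx σ) (by exact_mod_cast hc)
  obtain ⟨a, -, ha⟩ := intermediate_value_Icc hc hcont.continuousOn ⟨h0, h1⟩
  exact ⟨a, by rw [hsum]; exact congrArg _ ha⟩

section Lifting

variable {F M L : Type*} [Field F] [Field M] [Field L] [Algebra F M] [Algebra M L] [Algebra F L]
  [IsScalarTower F M L] {V : AddVal L} [V.IsGaloisStable F] [FiniteDimensional F L]
  [FiniteDimensional F M] [FiniteDimensional M L] [IsGalois F L] [IsGalois F M] [IsGalois M L]
  {x : L} {y : M} {a b : WithTop ℝ}

theorem IsGenerator.transition_eq (hx : V.IsGenerator F x) (hy : (V.base M).IsGenerator F y)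
    (hab : V.transition F x a = (V.base M).transition F y b) : V.transition M x a = b := by
  rw [hx.transition_comp hy] at hab
  exact le_antisymm ((V.base M).le_of_transition_le hab.le)
    ((V.base M).le_of_transition_le hab.ge)

theorem IsGenerator.exists_lift_of_le (hx : V.IsGenerator F x)
    (hy : (V.base M).IsGenerator F y)
    (hab : V.transition F x a = (V.base M).transition F y b) {δ : M ≃ₐ[F] M}
    (hδ : b ≤ (V.base M).v (δ y - y)) :
    ∃ σ : L ≃ₐ[F] L, (∀ m, σ (algebraMap M L m) = algebraMap M L (δ m)) ∧
      a ≤ V.v (σ x - x) := by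
  obtain ⟨σ, rfl⟩ := AlgEquiv.restrictNormalHom_surjective (F := F) (K₁ := M) L δ
  obtain ⟨h₀, -, h₁, -⟩ := hx.exists_lift hy σ
  refine ⟨σ * h₀.restrictScalars F, fun m => ?_, V.le_of_transition_le (F := M) (x := x) ?_⟩
  · rw [AlgEquiv.mul_apply, AlgEquiv.restrictScalars_apply, AlgEquiv.commutes]
    exact (AlgEquiv.restrictNormal_commutes σ M m).symm
  · rw [hx.transition_eq hy hab]
    refine hδ.trans_eq ?_
    rw [comap_v, map_sub]
    refine Eq.trans ?_ h₁
    congr 2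
    exact AlgEquiv.restrictNormal_commutes σ M y

theorem IsGenerator.le_v_restrict (hx : V.IsGenerator F x) (hy : (V.base M).IsGenerator F y)
    (hab : V.transition F x a = (V.base M).transition F y b) {σ : L ≃ₐ[F] L}
    (hσ : a ≤ V.v (σ x - x)) : b ≤ V.v (σ (algebraMap M L y) - algebraMap M L y) := by
  obtain ⟨h₀, h₁, h₂, -⟩ := hx.exists_lift hy σ
  rw [h₂, ← hx.transition_eq hy hab]
  exact V.monotone_transition M x (hσ.trans (h₁ 1))

end Lifting

section IntermediateField

variable {F Ω : Type*} [Field F] [Field Ω] [Algebra F Ω] {V : AddVal Ω}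

theorem isGaloisStable_base (hn : V.IsNormalizedOn F) (hh : V.IsHenselianOn F)
    (L : IntermediateField F Ω) [FiniteDimensional F L] [IsGalois F L] :
    (V.base L).IsGaloisStable F :=
  ⟨(V.base L).v_galois hn hh⟩

theorem exists_isGenerator_base (hn : V.IsNormalizedOn F) (hp : V.HasPerfectResidueFieldOn F)
    (L : IntermediateField F Ω) [FiniteDimensional F L] [IsGalois F L]
    [(V.base L).IsGaloisStable F] : ∃ x, (V.base L).IsGenerator F x := by
  obtain ⟨e, he⟩ := (V.base L).exists_isDiscrete (F := F) hn
  exact (V.base L).exists_integral_generator (F := F) hn hp he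

variable {M L : IntermediateField F Ω} [FiniteDimensional F M] [IsGalois F M]
  [FiniteDimensional F L] [IsGalois F L] [(V.base L).IsGaloisStable F]
  {x : L} {y : M} {a b : WithTop ℝ}

theorem exists_restrictNormalHom_eq [IsGalois F Ω] (h : M ≤ L) (hx : (V.base L).IsGenerator F x)
    (hy : (V.base M).IsGenerator F y)
    (hab : (V.base L).transition F x a = (V.base M).transition F y b) {δ : M ≃ₐ[F] M}
    (hδ : b ≤ (V.base M).v (δ y - y)) :
    ∃ γ : Ω ≃ₐ[F] Ω, AlgEquiv.restrictNormalHom M γ = δ ∧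
      a ≤ (V.base L).v (AlgEquiv.restrictNormalHom L γ x - x) := by
  let : Algebra M L := (IntermediateField.inclusion h).toAlgebra
  have : IsScalarTower F M L := IsScalarTower.of_algebraMap_eq fun _ => rfl
  have : FiniteDimensional M L := FiniteDimensional.right F M L
  have : IsGalois M L := IsGalois.tower_top_of_isGalois F M L
  obtain ⟨σ, h₁, h₂⟩ := IsGenerator.exists_lift_of_le (M := M) hx hy hab hδ
  obtain ⟨γ, rfl⟩ := AlgEquiv.restrictNormalHom_surjective (F := F) (K₁ := L) Ω σ
  refine ⟨γ, AlgEquiv.ext fun m => Subtype.ext ?_, h₂⟩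
  have h₃ := congrArg (algebraMap L Ω) (h₁ m)
  exact (AlgEquiv.restrictNormal_commutes γ M m).trans
    ((AlgEquiv.restrictNormal_commutes γ L (algebraMap M L m)).symm.trans h₃)

theorem le_v_restrictNormalHom (h : M ≤ L) (hx : (V.base L).IsGenerator F x)
    (hy : (V.base M).IsGenerator F y)
    (hab : (V.base L).transition F x a = (V.base M).transition F y b) {γ : Ω ≃ₐ[F] Ω}
    (hγ : a ≤ (V.base L).v (AlgEquiv.restrictNormalHom L γ x - x)) :
    b ≤ (V.base M).v (AlgEquiv.restrictNormalHom M γ y - y) := by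
  let : Algebra M L := (IntermediateField.inclusion h).toAlgebra
  have : IsScalarTower F M L := IsScalarTower.of_algebraMap_eq fun _ => rfl
  have : FiniteDimensional M L := FiniteDimensional.right F M L
  have : IsGalois M L := IsGalois.tower_top_of_isGalois F M L
  refine (IsGenerator.le_v_restrict (M := M) hx hy hab hγ).trans_eq ?_
  refine congrArg V.v (congrArg (· - (y : Ω)) ?_)
  exact (AlgEquiv.restrictNormal_commutes γ L (algebraMap M L y)).trans
    (AlgEquiv.restrictNormal_commutes γ M y).symm

end IntermediateField

end AddVal

/-- For every `r ≥ 0` and every finite Galois subextension `M/F` of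
`F^sep/F`, the restriction map `I_F^r → Gal(M/F)^r` is surjective: every `δ` in the
upper ramification subgroup `Gal(M/F)^r = Gal(M/F)_{ψ_{M/F}(r)}` is the restriction to
`M` of some `γ ∈ I_F^r ⊆ Γ_F`.  (Here `sM = ψ_{M/F}(r)`.) -/
theorem upperInertia_surjects_onto_upper_ramification
    {F Ω : Type*} [Field F] [Field Ω] [Algebra F Ω] [IsSepClosure F Ω]
    (V : AddVal Ω) (hnorm : V.IsNormalizedOn F) (hhens : V.IsHenselianOn F)
    (hperf : V.HasPerfectResidueFieldOn F)
    (r : ℝ) (hr : 0 ≤ r)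
    (M : IntermediateField F Ω) (hMfin : FiniteDimensional F ↥M)
    (hGal : IsGalois F ↥M) (eM : ℕ) (heM : V.IsRamIdx M eM)
    (sM : ℝ) (hsM0 : 0 ≤ sM) (hsM : herbrand V M eM sM = r) :
    ∀ δ : ↥M ≃ₐ[F] ↥M,
      xiRel V M eM sM (M.val.comp δ.toAlgHom) M.val →
      ∃ γ : Ω ≃ₐ[F] Ω, inUpperRam V r γ ∧ ∀ x : ↥M, γ (x : Ω) = ((δ x : ↥M) : Ω) := by
  intro δ hδ
  have hstable (L : FiniteGaloisIntermediateField F Ω) :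
      (V.base L).IsGaloisStable F := AddVal.isGaloisStable_base hnorm hhens L.toIntermediateField
  choose x hx using fun L : FiniteGaloisIntermediateField F Ω =>
    AddVal.exists_isGenerator_base hnorm hperf L.toIntermediateField
  have hpos (L : FiniteGaloisIntermediateField F Ω) (σ : L ≃ₐ[F] L) :
      0 ≤ (V.base L).v (σ (x L) - x L) :=
    (V.base L).le_v_sub
      (by rw [AddVal.IsGaloisStable.v_apply (V := V.base L)]; exact (hx L).1) (hx L).1
  choose a ha using fun L : FiniteGaloisIntermediateField F Ω =>
    (V.base L).exists_transition_eq (hpos L) (by linarith : 0 ≤ r + 1)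
  have hherb (L : FiniteGaloisIntermediateField F Ω) {e : ℕ} {s : ℝ}
      (he : V.IsRamIdx L.toIntermediateField e) (hs : 0 ≤ s)
      (h : herbrand V L.toIntermediateField e s = r) :
      (V.base L).transition F (x L) ((s + 1) / e : ℝ) = ((r + 1 : ℝ) : WithTop ℝ) := by
    rw [← h]
    exact ((hx L).herbrand_add_one hnorm hperf he hs).symm
  let M₀ : FiniteGaloisIntermediateField F Ω := .mk M
  let T (L : {L : FiniteGaloisIntermediateField F Ω // M₀ ≤ L}) : Set (Ω ≃ₐ[F] Ω) :=
    AlgEquiv.restrictNormalHom M ⁻¹' {δ} ∩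
      AlgEquiv.restrictNormalHom L.1 ⁻¹' {σ | a L.1 ≤ (V.base L.1).v (σ (x L.1) - x L.1)}
  have hT (L) : IsClosed (T L) := by
    have := krullTopology_discreteTopology_of_finiteDimensional F M
    have := krullTopology_discreteTopology_of_finiteDimensional F L.1
    exact ((isClosed_discrete _).preimage
      (InfiniteGalois.restrictNormalHom_continuous M)).inter
      ((isClosed_discrete _).preimage
        (InfiniteGalois.restrictNormalHom_continuous L.1.toIntermediateField))
  have hT_mono {L L'} (h : L ≤ L') : T L' ⊆ T L := fun γ hγ =>
    ⟨hγ.1, AddVal.le_v_restrictNormalHom h (hx _) (hx _) ((ha _).trans (ha _).symm) hγ.2⟩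
  have : Nonempty {L : FiniteGaloisIntermediateField F Ω // M₀ ≤ L} := ⟨M₀, le_rfl⟩
  obtain ⟨γ, hγ⟩ := IsCompact.nonempty_iInter_of_directed_nonempty_isCompact_isClosed T
    (fun L L' => ⟨⟨L.1 ⊔ L'.1, L.2.trans le_sup_left⟩, hT_mono (L' := ⟨_, _⟩) le_sup_left,
      hT_mono (L' := ⟨_, _⟩) le_sup_right⟩)
    (fun L => AddVal.exists_restrictNormalHom_eq L.2 (hx _) (hx M₀)
      ((ha _).trans (hherb M₀ heM hsM0 hsM).symm) (((hx M₀).xiRel_algEquiv_iff δ).mp hδ))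
    (fun L => (hT L).isCompact) hT
  rw [Set.mem_iInter] at hγ
  refine ⟨γ, fun M' e s hfin hgal he hs h => ?_, fun m => ?_⟩
  · let M₁ : FiniteGaloisIntermediateField F Ω := .mk M'
    have hcomp : γ.toAlgHom.comp M'.val =
        M'.val.comp (AlgEquiv.restrictNormalHom M' γ : M' →ₐ[F] M') :=
      AlgHom.ext fun m => (AlgEquiv.restrictNormal_commutes γ M' m).symm
    rw [hcomp]
    refine ((hx M₁).xiRel_algEquiv_iff _).mpr ?_
    exact AddVal.le_v_restrictNormalHom (L := (M₀ ⊔ M₁).toIntermediateField)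
      (le_sup_right : M₁ ≤ M₀ ⊔ M₁) (hx _) (hx M₁) ((ha _).trans (hherb M₁ he hs h).symm)
      (hγ ⟨M₀ ⊔ M₁, le_sup_left⟩).2
  · rw [← (hγ ⟨M₀, le_rfl⟩).1]
    exact (AlgEquiv.restrictNormal_commutes γ M m).symm
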